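/- arXiv:1903.00244 — 2 statements merged into one kernel-verified Lean document; each statement's English description precedes it below -/
import Mathlib

section
/- Assume the coercivity condition (C) and that B is a constant (independent of x ∈ 𝕋ⁿ) monotone real m×m matrix. Then the ergodic problem has a solution: there exist c = (c_i)_{i∈𝕀} ∈ ℝᵐ and v = (v_i)_{i∈𝕀} ∈ C(𝕋ⁿ)ᵐ such that v is a viscosity solution of Bv + H[v] = c in 𝕋ⁿ. -/
open MeasureTheory Filter Topology RealInnerProductSpace

noncomputable section

/-- Euclidean space ℝⁿ, the universal cover of the flat torus 𝕋ⁿ = ℝⁿ/ℤⁿ. -/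
abbrev Euc (n : ℕ) := EuclideanSpace ℝ (Fin n)

/-- A vector of ℝⁿ with integer coordinates (an element of ℤⁿ). -/
def IsIntVec {n : ℕ} (z : Euc n) : Prop := ∀ i, ∃ k : ℤ, z i = (k : ℝ)

/-- ℤⁿ-periodic functions on ℝⁿ: these represent functions on the torus 𝕋ⁿ. -/
def TorusFun {n : ℕ} {α : Type*} (f : Euc n → α) : Prop :=
  ∀ (x z : Euc n), IsIntVec z → f (x + z) = f x

/-- Functions on 𝕋ⁿ × Ξ, i.e. ℤⁿ-periodic in the first variable. -/
def TorusFun2 {n : ℕ} {Ξ : Type*} {α : Type*} (f : Euc n × Ξ → α) : Prop :=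
  ∀ (x z : Euc n) (ξ : Ξ), IsIntVec z → f (x + z, ξ) = f (x, ξ)

/-- The Hamiltonian H_{φ,i}(x,p) = sup_{ξ∈Ξ} (−g_i(x,ξ)·p − φ_i(x,ξ)). -/
def ham {n m : ℕ} {Ξ : Type*} (g : Fin m → Euc n × Ξ → Euc n)
    (φ : Fin m → Euc n × Ξ → ℝ) (i : Fin m) (x p : Euc n) : ℝ :=
  ⨆ ξ : Ξ, (-⟪g i (x, ξ), p⟫ - φ i (x, ξ))

/-- The data g = (g_i), L = (L_i) consist of continuous functions on 𝕋ⁿ × Ξ. -/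
def GoodData {n m : ℕ} {Ξ : Type*} [TopologicalSpace Ξ]
    (g : Fin m → Euc n × Ξ → Euc n) (L : Fin m → Euc n × Ξ → ℝ) : Prop :=
  (∀ i, Continuous (g i) ∧ TorusFun2 (g i)) ∧ (∀ i, Continuous (L i) ∧ TorusFun2 (L i))

/-- Coercivity (C): min_{x∈𝕋ⁿ} H_i(x,p) → ∞ as |p| → ∞. -/
def Coercive {n m : ℕ} {Ξ : Type*} (g : Fin m → Euc n × Ξ → Euc n)
    (L : Fin m → Euc n × Ξ → ℝ) : Prop :=
  ∀ (i : Fin m) (M : ℝ), ∃ R : ℝ, ∀ p : Euc n, R ≤ ‖p‖ → ∀ x : Euc n, M ≤ ham g L i x p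

/-- A monotone m×m real matrix. -/
def IsMonotoneMat {m : ℕ} (B : Matrix (Fin m) (Fin m) ℝ) : Prop :=
  ∀ (u : Fin m → ℝ) (k : Fin m), (∀ i, u i ≤ u k) → 0 ≤ u k → 0 ≤ ∑ j, B k j * u j

/-- Assumption (M): B(x) has continuous entries (as functions on 𝕋ⁿ) and is monotone
for every x. -/
def GoodCoupling {n m : ℕ} (B : Euc n → Matrix (Fin m) (Fin m) ℝ) : Prop :=
  (∀ i j, Continuous (fun x => B x i j) ∧ TorusFun (fun x => B x i j)) ∧
    ∀ x, IsMonotoneMat (B x)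

/-- Viscosity subsolution of λu + Bu + H_φ[u] = c in 𝕋ⁿ. -/
def IsSubsol {n m : ℕ} {Ξ : Type*} (B : Euc n → Matrix (Fin m) (Fin m) ℝ) (lam : ℝ)
    (g : Fin m → Euc n × Ξ → Euc n) (φ : Fin m → Euc n × Ξ → ℝ)
    (c : Fin m → ℝ) (u : Fin m → Euc n → ℝ) : Prop :=
  (∀ i, UpperSemicontinuous (u i) ∧ TorusFun (u i)) ∧
    ∀ (i : Fin m) (ψ : Euc n → ℝ), ContDiff ℝ 1 ψ → TorusFun ψ →
      ∀ x : Euc n, IsLocalMax (fun y => u i y - ψ y) x →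
        lam * u i x + (∑ j, B x i j * u j x) + ham g φ i x (gradient ψ x) ≤ c i

/-- Viscosity supersolution of λu + Bu + H_φ[u] = c in 𝕋ⁿ. -/
def IsSupersol {n m : ℕ} {Ξ : Type*} (B : Euc n → Matrix (Fin m) (Fin m) ℝ) (lam : ℝ)
    (g : Fin m → Euc n × Ξ → Euc n) (φ : Fin m → Euc n × Ξ → ℝ)
    (c : Fin m → ℝ) (u : Fin m → Euc n → ℝ) : Prop :=
  (∀ i, LowerSemicontinuous (u i) ∧ TorusFun (u i)) ∧
    ∀ (i : Fin m) (ψ : Euc n → ℝ), ContDiff ℝ 1 ψ → TorusFun ψ →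
      ∀ x : Euc n, IsLocalMin (fun y => u i y - ψ y) x →
        c i ≤ lam * u i x + (∑ j, B x i j * u j x) + ham g φ i x (gradient ψ x)

/-- Viscosity solution of λu + Bu + H_φ[u] = c in 𝕋ⁿ. -/
def IsSol {n m : ℕ} {Ξ : Type*} (B : Euc n → Matrix (Fin m) (Fin m) ℝ) (lam : ℝ)
    (g : Fin m → Euc n × Ξ → Euc n) (φ : Fin m → Euc n × Ξ → ℝ)
    (c : Fin m → ℝ) (u : Fin m → Euc n → ℝ) : Prop :=
  (∀ i, Continuous (u i)) ∧ IsSubsol B lam g φ c u ∧ IsSupersol B lam g φ c u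

/-- (φ,u) ∈ F(λ): φ ∈ C(𝕋ⁿ×Ξ)ᵐ, u ∈ C(𝕋ⁿ)ᵐ and u is a viscosity subsolution of
B^λ u + H_φ[u] = 0 in 𝕋ⁿ. -/
def memF {n m : ℕ} {Ξ : Type*} [TopologicalSpace Ξ]
    (B : Euc n → Matrix (Fin m) (Fin m) ℝ) (lam : ℝ)
    (g : Fin m → Euc n × Ξ → Euc n)
    (φ : Fin m → Euc n × Ξ → ℝ) (u : Fin m → Euc n → ℝ) : Prop :=
  (∀ i, Continuous (φ i) ∧ TorusFun2 (φ i)) ∧ (∀ i, Continuous (u i)) ∧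
    IsSubsol B lam g φ (fun _ => 0) u

/-- ρ_i(x) = Σ_j b_{ij}(x). -/
def rhoB {n m : ℕ} (B : Euc n → Matrix (Fin m) (Fin m) ℝ) (i : Fin m) (x : Euc n) : ℝ :=
  ∑ j, B x i j

/-- ν ∈ P_{B^λ}: a family of finite nonnegative Borel measures with ⟨ν, B^λ1⟩ = 1. -/
def memPB {n m : ℕ} {Ξ : Type*} [MeasurableSpace Ξ]
    (B : Euc n → Matrix (Fin m) (Fin m) ℝ) (lam : ℝ)
    (ν : Fin m → Measure (Euc n × Ξ)) : Prop :=
  (∀ i, IsFiniteMeasure (ν i)) ∧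
    (∑ i, ∫ q, (lam + rhoB B i q.1) ∂(ν i)) = 1

/-- ν ∈ G'(z,k,λ): ν ∈ P_{B^λ} and ⟨ν, φ − u_k(z) B^λ1⟩ ≥ 0 for every (φ,u) ∈ F(λ). -/
def memGP {n m : ℕ} {Ξ : Type*} [TopologicalSpace Ξ] [MeasurableSpace Ξ]
    (B : Euc n → Matrix (Fin m) (Fin m) ℝ) (lam : ℝ)
    (g : Fin m → Euc n × Ξ → Euc n) (z : Euc n) (k : Fin m)
    (ν : Fin m → Measure (Euc n × Ξ)) : Prop :=
  memPB B lam ν ∧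
    ∀ φ u, memF B lam g φ u →
      0 ≤ ∑ i, ∫ q, (φ i q - u k z * (lam + rhoB B i q.1)) ∂(ν i)

/-- μ ∈ P: a family of nonnegative Borel measures of total mass 1. -/
def memP {n m : ℕ} {Ξ : Type*} [MeasurableSpace Ξ]
    (μ : Fin m → Measure (Euc n × Ξ)) : Prop :=
  (∀ i, IsFiniteMeasure (μ i)) ∧ (∑ i, (μ i Set.univ).toReal) = 1

/-- μ ∈ P(z,k,λ): μ ∈ P and Σ_i ⟨μ_i, (λ+ρ_i)⁻¹ φ_i⟩ ≥ u_k(z) for all (φ,u) ∈ F(λ). -/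
def memPzk {n m : ℕ} {Ξ : Type*} [TopologicalSpace Ξ] [MeasurableSpace Ξ]
    (B : Euc n → Matrix (Fin m) (Fin m) ℝ) (lam : ℝ)
    (g : Fin m → Euc n × Ξ → Euc n) (z : Euc n) (k : Fin m)
    (μ : Fin m → Measure (Euc n × Ξ)) : Prop :=
  memP μ ∧
    ∀ φ u, memF B lam g φ u →
      u k z ≤ ∑ i, ∫ q, (lam + rhoB B i q.1)⁻¹ * φ i q ∂(μ i)

/-- μ ∈ P(0): μ ∈ P and ⟨μ,φ⟩ ≥ 0 for all (φ,u) ∈ F(0). -/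
def memP0 {n m : ℕ} {Ξ : Type*} [TopologicalSpace Ξ] [MeasurableSpace Ξ]
    (B : Euc n → Matrix (Fin m) (Fin m) ℝ)
    (g : Fin m → Euc n × Ξ → Euc n)
    (μ : Fin m → Measure (Euc n × Ξ)) : Prop :=
  memP μ ∧ ∀ φ u, memF B 0 g φ u → 0 ≤ ∑ i, ∫ q, φ i q ∂(μ i)

/-- μ ∈ M₊(0): a family of finite nonnegative Borel measures with ⟨μ,φ⟩ ≥ 0 for all
(φ,u) ∈ F(0). -/
def memM0 {n m : ℕ} {Ξ : Type*} [TopologicalSpace Ξ] [MeasurableSpace Ξ]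
    (B : Euc n → Matrix (Fin m) (Fin m) ℝ)
    (g : Fin m → Euc n × Ξ → Euc n)
    (μ : Fin m → Measure (Euc n × Ξ)) : Prop :=
  (∀ i, IsFiniteMeasure (μ i)) ∧ ∀ φ u, memF B 0 g φ u → 0 ≤ ∑ i, ∫ q, φ i q ∂(μ i)

/-- Assumption (E): problem (P₀) has a Lipschitz continuous viscosity solution. -/
def AssumptionE {n m : ℕ} {Ξ : Type*} (B : Euc n → Matrix (Fin m) (Fin m) ℝ)
    (g : Fin m → Euc n × Ξ → Euc n) (L : Fin m → Euc n × Ξ → ℝ) : Prop :=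
  ∃ v₀ : Fin m → Euc n → ℝ, (∀ i, ∃ K : NNReal, LipschitzWith K (v₀ i)) ∧
    IsSol B 0 g L (fun _ => 0) v₀

end


namespace ErgSys

variable {n : ℕ}

/-! ### Periodicity and the torus -/

lemma _root_.IsIntVec.neg_int {z : Euc n} (h : IsIntVec z) : IsIntVec (-z) := by
  intro i
  obtain ⟨k, hk⟩ := h i
  exact ⟨-k, by simp [hk]⟩

lemma exists_rep (x y : Euc n) : ∃ z : Euc n, IsIntVec z ∧ ∀ k, |(y - x - z) k| ≤ 1 / 2 := by
  refine ⟨WithLp.toLp 2 (fun k => ((round (y k - x k) : ℤ) : ℝ)), fun k => ⟨_, rfl⟩, fun k => ?_⟩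
  simpa using abs_sub_round (y k - x k)

lemma norm_le_of_half {t : Euc n} (h : ∀ k, |t k| ≤ 1 / 2) : ‖t‖ ≤ n := by
  have h1 : ‖t‖ ^ 2 ≤ (n : ℝ) := by
    rw [EuclideanSpace.norm_sq_eq]
    calc ∑ i, ‖t i‖ ^ 2 ≤ ∑ i : Fin n, (1 : ℝ) := by
          refine Finset.sum_le_sum fun i _ => ?_
          have := h i
          rw [Real.norm_eq_abs]
          have h0 := abs_nonneg (t i)
          nlinarith
      _ = n := by simp
  rcases Nat.eq_zero_or_pos n with h0 | h0
  · subst h0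
    have := norm_nonneg t
    simp at h1
    simp [h1]
  · have h2 : (1 : ℝ) ≤ n := by exact_mod_cast h0
    nlinarith [norm_nonneg t]

lemma _root_.TorusFun.sub_int {α : Type*} {f : Euc n → α} (hf : TorusFun f) (x z : Euc n)
    (hz : IsIntVec z) : f (x - z) = f x := by
  rw [sub_eq_add_neg]
  exact hf x (-z) hz.neg_int

lemma exists_max {f : Euc n → ℝ} (hc : Continuous f) (hf : TorusFun f) :
    ∃ x, ∀ y, f y ≤ f x := by
  obtain ⟨x, -, hx⟩ := (isCompact_closedBall (0 : Euc n) n).exists_isMaxOn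
    ⟨0, by simp⟩ hc.continuousOn
  refine ⟨x, fun y => ?_⟩
  obtain ⟨z, hz, h⟩ := exists_rep 0 y
  rw [← hf.sub_int y z hz]
  apply hx
  simpa using norm_le_of_half h

lemma exists_min {f : Euc n → ℝ} (hc : Continuous f) (hf : TorusFun f) :
    ∃ x, ∀ y, f x ≤ f y := by
  obtain ⟨x, hx⟩ := exists_max (f := fun y => - f y) hc.neg
    (fun x z hz => by simp only [hf x z hz])
  exact ⟨x, fun y => by have := hx y; linarith⟩

/-! ### The periodic penalty -/

/-- Periodic smooth penalty vanishing exactly on `x + ℤⁿ`. -/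
noncomputable def pq (x y : Euc n) : ℝ := ∑ k, Real.sin (Real.pi * (y k - x k)) ^ 2

lemma pq_contDiff (x : Euc n) : ContDiff ℝ 1 (pq x) := by
  unfold pq
  refine ContDiff.sum fun k _ => ?_
  refine ContDiff.pow (Real.contDiff_sin.comp ?_) 2
  refine contDiff_const.mul (ContDiff.sub ?_ contDiff_const)
  exact (EuclideanSpace.proj (𝕜 := ℝ) k).contDiff

lemma pq_torus (x : Euc n) : TorusFun (pq x) := by
  intro y z hz
  unfold pq
  refine Finset.sum_congr rfl fun k _ => ?_
  obtain ⟨j, hj⟩ := hz k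
  have : Real.pi * ((y + z) k - x k) = Real.pi * (y k - x k) + j * Real.pi := by
    simp [hj]; ring
  rw [this, Real.sin_add_int_mul_pi, mul_pow, ← zpow_natCast, ← zpow_mul, mul_comm j,
    zpow_mul]
  simp

lemma pq_nonneg (x y : Euc n) : 0 ≤ pq x y := Finset.sum_nonneg fun _ _ => sq_nonneg _

lemma pq_self (x : Euc n) : pq x x = 0 := by simp [pq]

lemma sin_lower {t : ℝ} (ht : |t| ≤ 1 / 2) : 4 * t ^ 2 ≤ Real.sin (Real.pi * t) ^ 2 := by
  have key : ∀ s : ℝ, 0 ≤ s → s ≤ 1 / 2 → 4 * s ^ 2 ≤ Real.sin (Real.pi * s) ^ 2 := by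
    intro s h0 h1
    have hp := Real.pi_pos
    have := Real.mul_le_sin (x := Real.pi * s) (by positivity) (by nlinarith)
    have h2 : 2 / Real.pi * (Real.pi * s) = 2 * s := by field_simp
    rw [h2] at this
    nlinarith
  rcases le_total 0 t with h | h
  · exact key t h (by rwa [abs_of_nonneg h] at ht)
  · have := key (-t) (by linarith) (by rwa [abs_of_nonpos h] at ht)
    simpa using this

lemma pq_lower {x y : Euc n} {z : Euc n} (hz : IsIntVec z)
    (h : ∀ k, |(y - x - z) k| ≤ 1 / 2) : 4 * ‖y - x - z‖ ^ 2 ≤ pq x y := by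
  rw [← (pq_torus x).sub_int y z hz, EuclideanSpace.norm_sq_eq, Finset.mul_sum]
  refine Finset.sum_le_sum fun k _ => ?_
  have := sin_lower (h k)
  rw [Real.norm_eq_abs, sq_abs]
  have e : (y - z) k - x k = (y - x - z) k := by
    simp only [PiLp.sub_apply]; ring
  rw [e]
  exact this

lemma penalize {F : Euc n → ℝ} (hc : Continuous F) (hF : TorusFun F) {x : Euc n}
    (hx : IsLocalMax F x) : ∃ A : ℝ, 0 ≤ A ∧ ∀ y, ∃ z, IsIntVec z ∧
      F y - A * pq x y ≤ F x - ‖y - x - z‖ ^ 2 := by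
  obtain ⟨r, hr, hball⟩ := Metric.eventually_nhds_iff.1 hx
  obtain ⟨xm, hm⟩ := exists_max hc hF
  have hM : 0 ≤ F xm - F x := by linarith [hm x]
  refine ⟨1 + (F xm - F x) / r ^ 2, by positivity, fun y => ?_⟩
  obtain ⟨z, hz, h⟩ := exists_rep x y
  refine ⟨z, hz, ?_⟩
  have hq := pq_lower hz h
  set t := ‖y - x - z‖ with ht
  have ht0 : 0 ≤ t := norm_nonneg _
  have hD : 0 ≤ (F xm - F x) / r ^ 2 := by positivity
  by_cases htr : t < r
  · have h1 : F y ≤ F x := by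
      rw [← hF.sub_int y z hz]
      apply hball
      rw [dist_eq_norm]
      convert htr using 1
      rw [ht]; congr 1; abel
    nlinarith [mul_nonneg hD (pq_nonneg x y), sq_nonneg t]
  · have h2 : r ^ 2 ≤ t ^ 2 := by
      have := not_lt.1 htr
      nlinarith
    have h3 : F xm - F x ≤ (F xm - F x) / r ^ 2 * pq x y := by
      calc F xm - F x = (F xm - F x) / r ^ 2 * r ^ 2 := by field_simp
        _ ≤ _ := by
          apply mul_le_mul_of_nonneg_left _ hD
          nlinarith
    nlinarith [hm y, sq_nonneg t]

/-! ### Gradients -/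

lemma grad_continuous {ψ : Euc n → ℝ} (h : ContDiff ℝ 1 ψ) : Continuous (gradient ψ) := by
  unfold gradient
  exact (LinearIsometryEquiv.continuous _).comp (h.continuous_fderiv one_ne_zero)

lemma grad_torus {ψ : Euc n → ℝ} (h : TorusFun ψ) : TorusFun (gradient ψ) := by
  intro x z hz
  unfold gradient
  congr 1
  have : (fun y => ψ (y + z)) = ψ := funext fun y => h y z hz
  rw [← fderiv_comp_add_right, this]

lemma norm_grad (ψ : Euc n → ℝ) (x : Euc n) : ‖gradient ψ x‖ = ‖fderiv ℝ ψ x‖ := by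
  unfold gradient
  exact LinearIsometryEquiv.norm_map _ _

lemma grad_eq_of_fderiv {f g : Euc n → ℝ} {x : Euc n} (h : fderiv ℝ f x = fderiv ℝ g x) :
    gradient f x = gradient g x := by
  unfold gradient; rw [h]

lemma grad_neg (f : Euc n → ℝ) (x : Euc n) : gradient (fun y => - f y) x = - gradient f x := by
  unfold gradient; rw [fderiv_fun_neg, map_neg]

lemma grad_eq_of_extr {f g : Euc n → ℝ} {x : Euc n} (hf : ContDiff ℝ 1 f) (hg : ContDiff ℝ 1 g)
    (h : IsLocalMax (fun y => f y - g y) x) : gradient f x = gradient g x := by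
  apply grad_eq_of_fderiv
  have := h.fderiv_eq_zero
  rw [fderiv_fun_sub (hf.differentiable one_ne_zero x) (hg.differentiable one_ne_zero x)] at this
  exact sub_eq_zero.1 this

lemma grad_const_extr {g : Euc n → ℝ} {x : Euc n} {a : ℝ}
    (h : IsLocalMax (fun y => a - g y) x) : gradient g x = 0 := by
  have := h.fderiv_eq_zero
  rw [fderiv_const_sub, neg_eq_zero] at this
  unfold gradient; rw [this, map_zero]

lemma grad_add_pq {ψ : Euc n → ℝ} (hψ : ContDiff ℝ 1 ψ) (A : ℝ) (hA : 0 ≤ A) (x : Euc n) :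
    gradient (fun y => ψ y + A * pq x y) x = gradient ψ x := by
  symm
  apply grad_eq_of_extr hψ (hψ.add (contDiff_const.mul (pq_contDiff x)))
  refine Filter.Eventually.of_forall fun y => ?_
  have := mul_nonneg hA (pq_nonneg x y)
  simp only [pq_self]
  linarith

/-! ### Localization of test functions -/

lemma exists_global {E : Type*} [NormedAddCommGroup E] [NormedSpace ℝ E] [HasContDiffBump E]
    [FiniteDimensional ℝ E]
    {f : E → ℝ} {x : E} (hf : ContDiffAt ℝ 1 f x) :
    ∃ F : E → ℝ, ContDiff ℝ 1 F ∧ F =ᶠ[𝓝 x] f := by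
  obtain ⟨r, hr, hb⟩ := Metric.eventually_nhds_iff.1 (hf.eventually (by simp))
  let b : ContDiffBump x := ⟨r / 4, r / 2, by positivity, by linarith⟩
  refine ⟨fun y => b y * f y, ?_, ?_⟩
  · rw [contDiff_iff_contDiffAt]
    intro y
    by_cases hy : y ∈ tsupport b
    · rw [b.tsupport_eq] at hy
      refine b.contDiff.contDiffAt.mul (hb ?_)
      have : dist y x ≤ r / 2 := hy
      linarith
    · have h0 := notMem_tsupport_iff_eventuallyEq.1 hy
      have : (fun y => b y * f y) =ᶠ[𝓝 y] fun _ => 0 := by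
        filter_upwards [h0] with w hw
        simp [hw]
      exact contDiffAt_const.congr_of_eventuallyEq this
  · filter_upwards [b.eventuallyEq_one] with y hy
    simp [hy]

lemma exists_saw : ∃ s : ℝ → ℝ, ContDiff ℝ 1 s ∧ (∀ t (k : ℤ), s (t + k) = s t) ∧
    s =ᶠ[𝓝 0] id := by
  obtain ⟨F, hF, hFe⟩ := exists_global (f := Real.arcsin) (x := 0)
    (Real.contDiffAt_arcsin (by norm_num) (by norm_num))
  refine ⟨fun t => F (Real.sin (2 * Real.pi * t)) / (2 * Real.pi), ?_, ?_, ?_⟩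
  · exact (hF.comp (Real.contDiff_sin.comp (contDiff_const.mul contDiff_id))).div_const _
  · intro t k
    have : 2 * Real.pi * (t + k) = 2 * Real.pi * t + k * (2 * Real.pi) := by ring
    simp only [this, Real.sin_add_int_mul_two_pi]
  · have hc : Tendsto (fun t : ℝ => Real.sin (2 * Real.pi * t)) (𝓝 0) (𝓝 0) := by
      have : Continuous (fun t : ℝ => Real.sin (2 * Real.pi * t)) := by fun_prop
      simpa using this.tendsto 0
    have h4 : ∀ᶠ t : ℝ in 𝓝 0, t ∈ Set.Ioo (-(1/4) : ℝ) (1/4) :=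
      Ioo_mem_nhds (by norm_num) (by norm_num)
    filter_upwards [hc.eventually hFe, h4] with t ht h
    have hp := Real.pi_pos
    simp only [ht, id]
    rw [Real.arcsin_sin (by nlinarith [h.1]) (by nlinarith [h.2])]
    field_simp

lemma localize {f : Euc n → ℝ} {x : Euc n} (hf : ContDiffAt ℝ 1 f x) :
    ∃ F : Euc n → ℝ, ContDiff ℝ 1 F ∧ TorusFun F ∧ F =ᶠ[𝓝 x] f := by
  obtain ⟨G, hG, hGe⟩ := exists_global hf
  obtain ⟨s, hs, hper, hse⟩ := exists_saw
  let Φ : Euc n → Euc n := fun y => WithLp.toLp 2 (fun k => x k + s (y k - x k))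
  have hΦ : ContDiff ℝ 1 Φ := by
    rw [contDiff_euclidean]
    intro k
    refine contDiff_const.add (hs.comp (ContDiff.sub ?_ contDiff_const))
    exact (EuclideanSpace.proj (𝕜 := ℝ) k).contDiff
  refine ⟨fun y => G (Φ y), hG.comp hΦ, ?_, ?_⟩
  · intro y z hz
    have : Φ (y + z) = Φ y := by
      ext k
      obtain ⟨j, hj⟩ := hz k
      have h2 : (y + z) k - x k = (y k - x k) + j := by simp [hj]; ring
      change x k + s ((y + z) k - x k) = x k + s (y k - x k)
      rw [h2, hper]
    simp only [this]
  · have h1 : ∀ᶠ y in 𝓝 x, Φ y = y := by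
      have : ∀ k, ∀ᶠ y : Euc n in 𝓝 x, s (y k - x k) = y k - x k := by
        intro k
        have hc : Tendsto (fun y : Euc n => y k - x k) (𝓝 x) (𝓝 0) := by
          have : Continuous (fun y : Euc n => y k - x k) := by fun_prop
          simpa using this.tendsto x
        exact hc.eventually hse
      filter_upwards [eventually_all.2 this] with y hy
      ext k
      change x k + s (y k - x k) = y k
      rw [hy k]; ring
    filter_upwards [h1, hGe] with y h1 h2
    rw [h1, h2]

end ErgSys

namespace ErgSys

variable {n : ℕ}

lemma torus_sub {f g : Euc n → ℝ} (hf : TorusFun f) (hg : TorusFun g) :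
    TorusFun (fun y => f y - g y) := fun y z hz => by simp only [hf y z hz, hg y z hz]

/-! ### Stability of contact points -/

lemma stab {f ψ : Euc n → ℝ} (hfc : Continuous f) (hft : TorusFun f) (hψ : ContDiff ℝ 1 ψ)
    (hψt : TorusFun ψ) {x : Euc n} (hx : IsLocalMax (fun y => f y - ψ y) x) {δ : ℝ}
    (hδ : 0 < δ) : ∃ ε > 0, ∀ w : Euc n → ℝ, Continuous w → TorusFun w →
      (∀ y, w y ≤ f y + ε) → f x - ε ≤ w x → ∃ (y : Euc n) (φ : Euc n → ℝ), ContDiff ℝ 1 φ ∧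
        TorusFun φ ∧ IsLocalMax (fun y => w y - φ y) y ∧ dist y x < δ ∧
        dist (gradient φ y) (gradient ψ x) < δ ∧ dist (w y) (f x) < δ := by
  obtain ⟨A, hA, hpen⟩ := penalize (F := fun y => f y - ψ y) (hfc.sub hψ.continuous)
    (torus_sub hft hψt) hx
  set φ : Euc n → ℝ := fun y => ψ y + A * pq x y with hφdef
  have hφ : ContDiff ℝ 1 φ := hψ.add (contDiff_const.mul (pq_contDiff x))
  have hφt : TorusFun φ := fun y z hz => by
    simp only [hφdef, hψt y z hz, pq_torus x y z hz]
  have hgr : gradient φ x = gradient ψ x := grad_add_pq hψ A hA x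
  have e1 : ∀ᶠ y in 𝓝 x, dist (gradient φ y) (gradient φ x) < δ :=
    Metric.tendsto_nhds.1 ((grad_continuous hφ).tendsto x) δ hδ
  have e2 : ∀ᶠ y in 𝓝 x, dist (φ y) (φ x) < δ / 2 :=
    Metric.tendsto_nhds.1 (hφ.continuous.tendsto x) _ (by positivity)
  have e3 : ∀ᶠ y in 𝓝 x, dist (f y) (f x) < δ / 2 :=
    Metric.tendsto_nhds.1 (hfc.tendsto x) _ (by positivity)
  obtain ⟨r, hr, hball⟩ := Metric.eventually_nhds_iff.1 ((e1.and e2).and e3)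
  set r' := min r δ with hr'
  have hr'0 : 0 < r' := lt_min hr hδ
  refine ⟨min (r' ^ 2 / 4) (δ / 2), by positivity, fun w hwc hwt hwf hwx => ?_⟩
  set ε := min (r' ^ 2 / 4) (δ / 2) with hε
  have hε1 : ε ≤ r' ^ 2 / 4 := min_le_left _ _
  have hε2 : ε ≤ δ / 2 := min_le_right _ _
  obtain ⟨y0, hy0⟩ := exists_max (f := fun y => w y - φ y) (hwc.sub hφ.continuous)
    (torus_sub hwt hφt)
  obtain ⟨z, hz, hzz⟩ := hpen y0
  have hmax : ∀ y, w y - φ y ≤ w (y0 - z) - φ (y0 - z) := by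
    intro y
    rw [hwt.sub_int _ _ hz, hφt.sub_int _ _ hz]
    exact hy0 y
  have hφx : φ x = ψ x := by simp [hφdef, pq_self]
  have hdist : dist (y0 - z) x < r' := by
    rw [dist_eq_norm]
    have : y0 - z - x = y0 - x - z := by abel
    rw [this]
    have h1 := hy0 x
    have h2 := hwf y0
    simp only [hφdef, pq_self] at h1
    have h3 : ‖y0 - x - z‖ ^ 2 < r' ^ 2 := by nlinarith
    exact lt_of_pow_lt_pow_left₀ 2 hr'0.le h3
  obtain ⟨⟨b1, b2⟩, b3⟩ := hball (lt_of_lt_of_le hdist (min_le_left _ _))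
  refine ⟨y0 - z, φ, hφ, hφt, Filter.Eventually.of_forall hmax,
    lt_of_lt_of_le hdist (min_le_right _ _), hgr ▸ b1, ?_⟩
  have h1 := hmax x
  have h2 := hwf (y0 - z)
  rw [Real.dist_eq, abs_lt] at b2 b3 ⊢
  constructor <;> linarith [b2.1, b2.2, b3.1, b3.2]

lemma sub_core {H : Euc n → Euc n → ℝ} (hH : Continuous fun q : Euc n × Euc n => H q.1 q.2)
    {f ψ T : Euc n → ℝ} (hT : Continuous T) (a : ℝ)
    (hfc : Continuous f) (hft : TorusFun f) (hψ : ContDiff ℝ 1 ψ)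
    (hψt : TorusFun ψ) {x : Euc n} (hx : IsLocalMax (fun y => f y - ψ y) x)
    (hw : ∀ ε > 0, ∃ w : Euc n → ℝ, Continuous w ∧ TorusFun w ∧ (∀ y, w y ≤ f y + ε) ∧
      f x - ε ≤ w x ∧ ∀ φ, ContDiff ℝ 1 φ → TorusFun φ → ∀ y,
        IsLocalMax (fun y => w y - φ y) y → a * w y + T y + H y (gradient φ y) ≤ ε) :
    a * f x + T x + H x (gradient ψ x) ≤ 0 := by
  by_contra hcon
  push Not at hcon
  set s := a * f x + T x + H x (gradient ψ x) with hs
  let Θ : ℝ × Euc n × Euc n → ℝ := fun q => a * q.1 + T q.2.1 + H q.2.1 q.2.2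
  have hΘ : Continuous Θ :=
    ((continuous_const.mul continuous_fst).add (hT.comp (continuous_fst.comp continuous_snd))).add
      (hH.comp continuous_snd)
  have hev : ∀ᶠ q in 𝓝 (f x, x, gradient ψ x), s / 2 < Θ q :=
    (hΘ.tendsto _).eventually (lt_mem_nhds (by change s / 2 < s; linarith))
  obtain ⟨δ, hδ, hball⟩ := Metric.eventually_nhds_iff.1 hev
  obtain ⟨ε, hε, hst⟩ := stab hfc hft hψ hψt hx hδ
  obtain ⟨w, hwc, hwt, hwf, hwx, hwsub⟩ := hw (min ε (s / 2)) (by positivity)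
  have m1 := min_le_left ε (s / 2)
  have m2 := min_le_right ε (s / 2)
  obtain ⟨y, φ, hφ, hφt, hloc, d1, d2, d3⟩ := hst w hwc hwt
    (fun y => (hwf y).trans (by linarith)) (le_trans (by linarith) hwx)
  have h1 := hwsub φ hφ hφt y hloc
  have h2 := hball (y := (w y, y, gradient φ y)) (by
    rw [Prod.dist_eq, Prod.dist_eq]
    exact max_lt d3 (max_lt d1 d2))
  change s / 2 < a * w y + T y + H y (gradient φ y) at h2
  linarith

lemma sup_core {H : Euc n → Euc n → ℝ} (hH : Continuous fun q : Euc n × Euc n => H q.1 q.2)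
    {f ψ T : Euc n → ℝ} (hT : Continuous T) (a : ℝ)
    (hfc : Continuous f) (hft : TorusFun f) (hψ : ContDiff ℝ 1 ψ)
    (hψt : TorusFun ψ) {x : Euc n} (hx : IsLocalMin (fun y => f y - ψ y) x)
    (hw : ∀ ε > 0, ∃ w : Euc n → ℝ, Continuous w ∧ TorusFun w ∧ (∀ y, f y - ε ≤ w y) ∧
      w x ≤ f x + ε ∧ ∀ φ, ContDiff ℝ 1 φ → TorusFun φ → ∀ y,
        IsLocalMin (fun y => w y - φ y) y → -ε ≤ a * w y + T y + H y (gradient φ y)) :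
    0 ≤ a * f x + T x + H x (gradient ψ x) := by
  have key := sub_core (H := fun y p => - H y (-p)) (f := fun y => - f y) (ψ := fun y => - ψ y)
    (T := fun y => - T y) (x := x)
    ((hH.comp (continuous_fst.prodMk continuous_snd.neg)).neg) hT.neg a hfc.neg
    (fun y z hz => by simp only [hft y z hz]) hψ.neg (fun y z hz => by simp only [hψt y z hz])
    (by
      filter_upwards [hx] with y hy
      linarith)
    (by
      intro ε hε
      obtain ⟨w, hwc, hwt, hwf, hwx, hsup⟩ := hw ε hε
      refine ⟨fun y => - w y, hwc.neg, fun y z hz => by simp only [hwt y z hz],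
        fun y => by linarith [hwf y], by linarith, fun φ hφ hφt y hy => ?_⟩
      have := hsup (fun y => - φ y) hφ.neg (fun y z hz => by simp only [hφt y z hz]) y (by
        filter_upwards [hy] with y' hy'
        linarith)
      rw [grad_neg] at this
      linarith)
  rw [grad_neg, neg_neg] at key
  linarith

/-! ### Lipschitz bound for subsolutions of coercive equations -/

lemma lip_of_coer {u : Euc n → ℝ} (hc : Continuous u) (ht : TorusFun u) {R : ℝ} (hR : 0 < R)
    (h : ∀ ψ : Euc n → ℝ, ContDiff ℝ 1 ψ → TorusFun ψ → ∀ x,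
      IsLocalMax (fun y => u y - ψ y) x → ‖gradient ψ x‖ < R) (x y : Euc n) :
    u y - u x ≤ R * ‖y - x‖ := by
  obtain ⟨xM, hM⟩ := exists_max hc ht
  have hM0 : 0 ≤ u xM - u x := by linarith [hM x]
  set ρ := (u xM - u x) / R + 1 with hρ
  have hρ0 : 0 < ρ := by positivity
  have hfc : Continuous fun y => u y - R * ‖y - x‖ := by fun_prop
  obtain ⟨y0, -, hy0⟩ := (isCompact_closedBall x ρ).exists_isMaxOn
    ⟨x, by simp [hρ0.le]⟩ hfc.continuousOn
  have hxx : u x ≤ u y0 - R * ‖y0 - x‖ := by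
    have := hy0 (show x ∈ Metric.closedBall x ρ by simp [hρ0.le])
    simpa using this
  have hglob : ∀ y, u y - R * ‖y - x‖ ≤ u y0 - R * ‖y0 - x‖ := by
    intro y
    by_cases hy : y ∈ Metric.closedBall x ρ
    · exact hy0 hy
    · have : ρ < ‖y - x‖ := by
        rw [Metric.mem_closedBall, dist_eq_norm] at hy
        exact not_le.1 hy
      have h1 : R * ρ ≤ R * ‖y - x‖ := by nlinarith
      have h2 : R * ρ = (u xM - u x) + R := by rw [hρ]; field_simp
      linarith [hM y]
  by_cases hyx : y0 = x
  · have := hglob y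
    rw [hyx] at this
    simp at this
    linarith
  · exfalso
    have hne : y0 - x ≠ 0 := sub_ne_zero.2 hyx
    have : Nontrivial (Euc n) := ⟨⟨y0 - x, 0, hne⟩⟩
    have hcd : ContDiffAt ℝ 1 (fun y => R * ‖y - x‖) y0 :=
      contDiffAt_const.mul ((contDiffAt_id.sub contDiffAt_const).norm ℝ hne)
    obtain ⟨F, hF, hFt, hFe⟩ := localize hcd
    have hlt := h F hF hFt y0 (by
      filter_upwards [hFe] with y hy
      rw [hFe.self_of_nhds, hy]
      exact hglob y)
    rw [hFe.gradient_eq, norm_grad] at hlt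
    have hd : DifferentiableAt ℝ (fun y : Euc n => ‖y‖) (y0 - x) :=
      (contDiffAt_norm ℝ hne (n := 1)).differentiableAt one_ne_zero
    have hd2 : DifferentiableAt ℝ (fun y : Euc n => ‖y - x‖) y0 :=
      (((contDiffAt_id.sub contDiffAt_const).norm ℝ hne : ContDiffAt ℝ 1 _ _)).differentiableAt
        one_ne_zero
    rw [fderiv_const_mul hd2, norm_smul, fderiv_comp_sub (f := fun y : Euc n => ‖y‖),
      norm_fderiv_norm hd, Real.norm_of_nonneg hR.le] at hlt
    linarith

lemma dense_bound {u T : Euc n → ℝ} (hc : Continuous u) (ht : TorusFun u) (hT : Continuous T)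
    {C : ℝ} (h : ∀ ψ : Euc n → ℝ, ContDiff ℝ 1 ψ → TorusFun ψ → ∀ x,
      IsLocalMax (fun y => u y - ψ y) x → T x ≤ C) (x : Euc n) : T x ≤ C := by
  by_contra hcon
  push Not at hcon
  obtain ⟨δ, hδ, hball⟩ := Metric.eventually_nhds_iff.1
    ((hT.tendsto x).eventually (lt_mem_nhds hcon))
  obtain ⟨xM, hM⟩ := exists_max hc ht
  have hM0 : 0 ≤ u xM - u x := by linarith [hM x]
  set A := (u xM - u x + 1) / δ ^ 2 with hA
  have hA0 : 0 < A := by positivity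
  have hψ : ContDiff ℝ 1 fun y => A * pq x y := contDiff_const.mul (pq_contDiff x)
  have hψt : TorusFun fun y => A * pq x y := fun y z hz => by
    simp only [pq_torus x y z hz]
  obtain ⟨y0, hy0⟩ := exists_max (f := fun y => u y - A * pq x y) (hc.sub hψ.continuous)
    (torus_sub ht hψt)
  obtain ⟨z, hz, hzz⟩ := exists_rep x y0
  have hq := pq_lower hz hzz
  have hmax : ∀ y, u y - A * pq x y ≤ u (y0 - z) - A * pq x (y0 - z) := by
    intro y
    rw [ht.sub_int _ _ hz, (pq_torus x).sub_int _ _ hz]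
    exact hy0 y
  have h1 := h _ hψ hψt (y0 - z) (Filter.Eventually.of_forall hmax)
  have h2 : C < T (y0 - z) := by
    apply hball
    rw [dist_eq_norm]
    have : y0 - z - x = y0 - x - z := by abel
    rw [this]
    have h3 := hy0 x
    simp only [pq_self] at h3
    have h4 : A * δ ^ 2 = u xM - u x + 1 := by rw [hA]; field_simp
    have h5 : A * ‖y0 - x - z‖ ^ 2 < A * δ ^ 2 := by
      have := mul_le_mul_of_nonneg_left hq hA0.le
      nlinarith [hM y0, sq_nonneg ‖y0 - x - z‖, mul_nonneg hA0.le (sq_nonneg ‖y0 - x - z‖)]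
    exact lt_of_pow_lt_pow_left₀ 2 hδ.le (lt_of_mul_lt_mul_left h5 hA0.le)
  linarith

end ErgSys

namespace ErgSys

variable {n : ℕ}

/-- Continuous, periodic, coercive Hamiltonian. -/
structure HGood (H : Euc n → Euc n → ℝ) : Prop where
  cont : Continuous fun q : Euc n × Euc n => H q.1 q.2
  per : ∀ x z p, IsIntVec z → H (x + z) p = H x p
  coer : ∀ M : ℝ, ∃ R : ℝ, ∀ p, R ≤ ‖p‖ → ∀ x, M ≤ H x p

/-- Continuous periodic families. -/
def CP {ι : Type*} (u : ι → Euc n → ℝ) : Prop := ∀ i, Continuous (u i) ∧ TorusFun (u i)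

/-- Viscosity subsolution inequality for a system. -/
def SubS {ι : Type*} [Fintype ι] (B : ι → ι → ℝ) (H : ι → Euc n → Euc n → ℝ) (c : ι → ℝ)
    (u : ι → Euc n → ℝ) : Prop :=
  ∀ (i : ι) (ψ : Euc n → ℝ), ContDiff ℝ 1 ψ → TorusFun ψ → ∀ x : Euc n,
    IsLocalMax (fun y => u i y - ψ y) x →
      (∑ j, B i j * u j x) + H i x (gradient ψ x) ≤ c i

/-- Viscosity supersolution inequality for a system. -/
def SupS {ι : Type*} [Fintype ι] (B : ι → ι → ℝ) (H : ι → Euc n → Euc n → ℝ) (c : ι → ℝ)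
    (u : ι → Euc n → ℝ) : Prop :=
  ∀ (i : ι) (ψ : Euc n → ℝ), ContDiff ℝ 1 ψ → TorusFun ψ → ∀ x : Euc n,
    IsLocalMin (fun y => u i y - ψ y) x →
      c i ≤ (∑ j, B i j * u j x) + H i x (gradient ψ x)

lemma HGood.lip {H : Euc n → Euc n → ℝ} (hH : HGood H) (K : ℝ) :
    ∃ R > 0, ∀ u : Euc n → ℝ, Continuous u → TorusFun u →
      (∀ ψ : Euc n → ℝ, ContDiff ℝ 1 ψ → TorusFun ψ → ∀ x,
        IsLocalMax (fun y => u y - ψ y) x → H x (gradient ψ x) ≤ K) →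
      ∀ x y, u y - u x ≤ R * ‖y - x‖ := by
  obtain ⟨R, hR⟩ := hH.coer (K + 1)
  refine ⟨max R 1, by positivity, fun u hc ht h x y => ?_⟩
  refine lip_of_coer hc ht (by positivity) (fun ψ hψ hψt x hx => ?_) x y
  by_contra hcon
  have h1 := hR (gradient ψ x) ((le_max_left _ _).trans (not_lt.1 hcon)) x
  have h2 := h ψ hψ hψt x hx
  linarith

lemma cont_of_lip {u : Euc n → ℝ} {R : ℝ} (hR : 0 ≤ R)
    (h : ∀ x y, u y - u x ≤ R * ‖y - x‖) : Continuous u := by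
  refine (LipschitzWith.of_le_add_mul ⟨R, hR⟩ fun x y => ?_).continuous
  have := h y x
  rw [dist_eq_norm]
  change u x ≤ u y + R * ‖x - y‖
  linarith

section alg
variable {ι : Type*} [Fintype ι]

lemma row_mono {b u w : ι → ℝ} {i : ι} (hb : ∀ j, j ≠ i → b j ≤ 0) (h : ∀ j, j ≠ i → u j ≤ w j)
    (hi : u i = w i) : ∑ j, b j * w j ≤ ∑ j, b j * u j := by
  refine Finset.sum_le_sum fun j _ => ?_
  by_cases hj : j = i
  · subst hj; rw [hi]
  · exact mul_le_mul_of_nonpos_left (h j hj) (hb j hj)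

lemma upd_sum [DecidableEq ι] (b u : ι → ℝ) (i : ι) (r : ℝ) :
    ∑ j, b j * Function.update u i r j = ∑ j, b j * u j - b i * u i + b i * r := by
  have : ∀ j, b j * Function.update u i r j = b j * u j + (if j = i then b i * (r - u i) else 0) := by
    intro j
    by_cases hj : j = i
    · subst hj; simp; ring
    · simp [hj]
  simp_rw [this, Finset.sum_add_distrib]
  simp; ring

lemma sub_le {B : ι → ι → ℝ} (hoff : ∀ i j, j ≠ i → B i j ≤ 0) {lam : ℝ} (hl : 0 < lam)
    (hrow : ∀ i, lam ≤ ∑ j, B i j) {H : ι → Euc n → Euc n → ℝ} {C : ℝ} (hC0 : 0 ≤ C)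
    (hC : ∀ i x, |H i x 0| ≤ C) {u : ι → Euc n → ℝ} (hu : CP u)
    (hs : SubS B H (fun _ => 0) u) (i : ι) (x : Euc n) : u i x ≤ C / lam := by
  choose X hX using fun i => exists_max (hu i).1 (hu i).2
  have : Nonempty ι := ⟨i⟩
  obtain ⟨k, hk⟩ := Finite.exists_max fun i => u i (X i)
  refine ((hX i x).trans (hk i)).trans ?_
  rw [le_div_iff₀ hl]
  by_cases hM : u k (X k) ≤ 0
  · nlinarith
  push Not at hM
  have h1 := hs k (fun _ => 0) contDiff_const (fun _ _ _ => rfl) (X k)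
    (Filter.Eventually.of_forall fun y => by simpa using hX k y)
  rw [gradient_fun_const] at h1
  have h2 : ∑ j, B k j * u k (X k) ≤ ∑ j, B k j * u j (X k) :=
    row_mono (i := k) (hoff k) (fun j _ => (hX j _).trans (hk j)) rfl
  rw [← Finset.sum_mul] at h2
  have h3 := neg_le_of_abs_le (hC k (X k))
  nlinarith [hrow k]

theorem perron [DecidableEq ι] {B : ι → ι → ℝ} (hoff : ∀ i j, j ≠ i → B i j ≤ 0) {lam : ℝ}
    (hl : 0 < lam) (hrow : ∀ i, lam ≤ ∑ j, B i j) {H : ι → Euc n → Euc n → ℝ}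
    (hH : ∀ i, HGood (H i)) {C : ℝ} (hC0 : 0 ≤ C) (hC : ∀ i x, |H i x 0| ≤ C) :
    ∃ u : ι → Euc n → ℝ, CP u ∧ SubS B H (fun _ => 0) u ∧ SupS B H (fun _ => 0) u ∧
      ∀ i x, |u i x| ≤ C / lam := by
  set S : Set (ι → Euc n → ℝ) :=
    {w | CP w ∧ SubS B H (fun _ => 0) w ∧ ∀ i x, -(C / lam) ≤ w i x} with hS
  have hCl : 0 ≤ C / lam := by positivity
  have hSle : ∀ w ∈ S, ∀ i x, w i x ≤ C / lam := fun w hw i x =>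
    sub_le hoff hl hrow hC0 hC hw.1 hw.2.1 i x
  have hSne : (fun _ _ => -(C / lam) : ι → Euc n → ℝ) ∈ S := by
    refine ⟨fun i => ⟨continuous_const, fun _ _ _ => rfl⟩, ?_, fun _ _ => le_rfl⟩
    intro i ψ hψ hψt x hx
    rw [grad_const_extr hx, ← Finset.sum_mul]
    have h1 := le_of_abs_le (hC i x)
    have h2 : lam * (C / lam) ≤ (∑ j, B i j) * (C / lam) :=
      mul_le_mul_of_nonneg_right (hrow i) hCl
    have h3 : lam * (C / lam) = C := by field_simp
    linarith
  have hlip : ∀ i, ∃ R > 0, ∀ w ∈ S, ∀ x y, w i y - w i x ≤ R * ‖y - x‖ := by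
    intro i
    obtain ⟨R, hR, h⟩ := (hH i).lip ((∑ j, |B i j|) * (C / lam))
    refine ⟨R, hR, fun w hw => h (w i) (hw.1 i).1 (hw.1 i).2 fun ψ hψ hψt x hx => ?_⟩
    have h1 := hw.2.1 i ψ hψ hψt x hx
    have h2 : -((∑ j, |B i j|) * (C / lam)) ≤ ∑ j, B i j * w j x := by
      rw [Finset.sum_mul, ← Finset.sum_neg_distrib]
      refine Finset.sum_le_sum fun j _ => ?_
      have h3 : |B i j * w j x| ≤ |B i j| * (C / lam) := by
        rw [abs_mul]
        exact mul_le_mul_of_nonneg_left (abs_le.2 ⟨hw.2.2 j x, hSle w hw j x⟩) (abs_nonneg _)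
      exact neg_le_of_abs_le h3
    linarith
  choose R hR hlip using hlip
  have : Nonempty S := ⟨⟨_, hSne⟩⟩
  let u : ι → Euc n → ℝ := fun i x => ⨆ w : S, w.1 i x
  have hbdd : ∀ i x, BddAbove (Set.range fun w : S => w.1 i x) := fun i x =>
    ⟨C / lam, by rintro _ ⟨w, rfl⟩; exact hSle w.1 w.2 i x⟩
  have hle : ∀ w ∈ S, ∀ i x, w i x ≤ u i x := fun w hw i x => le_ciSup (hbdd i x) ⟨w, hw⟩
  have hul : ∀ i x y, u i y - u i x ≤ R i * ‖y - x‖ := by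
    intro i x y
    have : u i y ≤ u i x + R i * ‖y - x‖ := by
      refine ciSup_le fun w => ?_
      have h1 := hlip i w.1 w.2 x y
      have h2 := hle w.1 w.2 i x
      linarith
    linarith
  have huCP : CP u := by
    refine fun i => ⟨cont_of_lip (hR i).le (hul i), fun x z hz => ?_⟩
    change (⨆ w : S, w.1 i (x + z)) = ⨆ w : S, w.1 i x
    exact congrArg _ (funext fun w => (w.2.1 i).2 x z hz)
  have hulow : ∀ i x, -(C / lam) ≤ u i x := fun i x => hle _ hSne i x
  have hTc : ∀ i, Continuous fun y => ∑ j, B i j * u j y - B i i * u i y := fun i =>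
    (continuous_finsetSum _ fun j _ => continuous_const.mul (huCP j).1).sub
      (continuous_const.mul (huCP i).1)
  have husub : SubS B H (fun _ => 0) u := by
    intro i ψ hψ hψt x hx
    have := sub_core (hH i).cont (hTc i) (B i i) (huCP i).1 (huCP i).2 hψ hψt hx (by
      intro ε hε
      obtain ⟨w, hw⟩ := exists_lt_of_lt_ciSup (show u i x - ε < ⨆ w : S, w.1 i x by
        change u i x - ε < u i x; linarith)
      refine ⟨w.1 i, (w.2.1 i).1, (w.2.1 i).2, fun y => ?_, hw.le, fun φ hφ hφt y hy => ?_⟩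
      · have := hle w.1 w.2 i y
        linarith
      · have h1 := w.2.2.1 i φ hφ hφt y hy
        have h2 := upd_sum (B i) (fun j => u j y) i (w.1 i y)
        have h3 := row_mono (b := B i) (i := i) (u := fun j => w.1 j y)
          (w := Function.update (fun j => u j y) i (w.1 i y)) (hoff i)
          (fun j hj => by simpa [hj] using hle w.1 w.2 j y) (by simp)
        linarith)
    linarith
  refine ⟨u, huCP, husub, ?_, fun i x => abs_le.2 ⟨hulow i x,
    sub_le hoff hl hrow hC0 hC huCP husub i x⟩⟩
  intro i ψ hψ hψt x hx
  by_contra hcon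
  push Not at hcon
  obtain ⟨A, hA, hpen⟩ := penalize (F := fun y => ψ y - u i y) (hψ.continuous.sub (huCP i).1)
    (torus_sub hψt (huCP i).2) (x := x) (by
      filter_upwards [hx] with y hy
      linarith)
  set φ : Euc n → ℝ := fun y => ψ y - A * pq x y + (u i x - ψ x) with hφdef
  have hφ : ContDiff ℝ 1 φ :=
    (hψ.sub (contDiff_const.mul (pq_contDiff x))).add contDiff_const
  have hφt : TorusFun φ := fun y z hz => by
    simp only [hφdef, hψt y z hz, pq_torus x y z hz]
  have hφx : φ x = u i x := by simp [hφdef, pq_self]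
  have hgr : gradient φ x = gradient ψ x := by
    apply grad_eq_of_extr hφ hψ
    refine Filter.Eventually.of_forall fun y => ?_
    have := mul_nonneg hA (pq_nonneg x y)
    simp only [hφdef, pq_self]
    linarith
  let Θ : ℝ × Euc n → ℝ := fun q =>
    (∑ j, B i j * u j q.2 - B i i * u i q.2) + B i i * (φ q.2 + q.1) + H i q.2 (gradient φ q.2)
  have hΘ : Continuous Θ := by
    refine (((hTc i).comp continuous_snd).add (continuous_const.mul
      ((hφ.continuous.comp continuous_snd).add continuous_fst))).add ?_
    exact (hH i).cont.comp (continuous_snd.prodMk ((grad_continuous hφ).comp continuous_snd))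
  have hΘ0 : Θ (0, x) < 0 := by
    simp only [Θ, hφx, hgr]
    linarith
  obtain ⟨δ, hδ, hball⟩ := Metric.eventually_nhds_iff.1
    ((hΘ.tendsto (0, x)).eventually (gt_mem_nhds hΘ0))
  set ε := min (δ / 2) (δ ^ 2) with hεdef
  have hε : 0 < ε := by positivity
  have hΘneg : ∀ y, u i y < φ y + ε → Θ (ε, y) < 0 := by
    intro y hy
    obtain ⟨z, hz, hzz⟩ := hpen y
    have hper : Θ (ε, y - z) = Θ (ε, y) := by
      have hHp : ∀ p, TorusFun fun y => H i y p := fun p y z hz => (hH i).per y z p hz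
      simp only [Θ, hφt.sub_int y z hz, (grad_torus hφt).sub_int y z hz,
        fun j => (huCP j).2.sub_int y z hz, (hHp _).sub_int y z hz]
    rw [← hper]
    apply hball
    rw [Prod.dist_eq]
    refine max_lt ?_ ?_
    · simp only [Real.dist_eq, sub_zero, abs_of_pos hε]
      have := min_le_left (δ / 2) (δ ^ 2)
      linarith
    · simp only [dist_eq_norm]
      have e : y - z - x = y - x - z := by abel
      rw [e]
      have h1 : ‖y - x - z‖ ^ 2 < δ ^ 2 := by
        have := min_le_right (δ / 2) (δ ^ 2)
        simp only [hφdef] at hy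
        linarith
      exact lt_of_pow_lt_pow_left₀ 2 hδ.le h1
  set w : ι → Euc n → ℝ := Function.update u i (fun y => max (u i y) (φ y + ε)) with hwdef
  have hwi : w i = fun y => max (u i y) (φ y + ε) := by simp [hwdef]
  have hwj : ∀ j, j ≠ i → w j = u j := fun j hj => by simp [hwdef, hj]
  have hwu : ∀ j y, u j y ≤ w j y := by
    intro j y
    by_cases hj : j = i
    · subst hj; rw [hwi]; exact le_max_left _ _
    · rw [hwj j hj]
  have hwS : w ∈ S := by
    refine ⟨fun j => ?_, ?_, fun j y => (hulow j y).trans (hwu j y)⟩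
    · by_cases hj : j = i
      · subst hj
        rw [hwi]
        refine ⟨(huCP j).1.max (hφ.continuous.add continuous_const), fun y z hz => ?_⟩
        simp only [(huCP j).2 y z hz, hφt y z hz]
      · rw [hwj j hj]; exact huCP j
    · intro k ψ' hψ' hψ't y hy
      by_cases hk : k = i
      · subst hk
        rw [hwi] at hy
        by_cases hcase : φ y + ε ≤ u k y
        · have hval : ∀ j, w j y = u j y := by
            intro j
            by_cases hj : j = k
            · subst hj; rw [hwi]; exact max_eq_left hcase
            · rw [hwj j hj]
          simp_rw [hval]
          refine husub k ψ' hψ' hψ't y ?_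
          filter_upwards [hy] with y' hy'
          simp only [max_eq_left hcase] at hy'
          have := le_max_left (u k y') (φ y' + ε)
          linarith
        · push Not at hcase
          have hval : ∀ j, w j y = Function.update (fun j => u j y) k (φ y + ε) j := by
            intro j
            by_cases hj : j = k
            · subst hj; rw [hwi]; simpa using hcase.le
            · rw [hwj j hj]; simp [hj]
          simp_rw [hval, upd_sum]
          have hg : gradient φ y = gradient ψ' y := by
            apply grad_eq_of_extr hφ hψ'
            filter_upwards [hy] with y' hy'
            simp only [max_eq_right hcase.le] at hy'
            have := le_max_right (u k y') (φ y' + ε)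
            linarith
          have := hΘneg y hcase
          simp only [Θ] at this
          rw [← hg]
          linarith
      · rw [hwj k hk] at hy
        have h1 := husub k ψ' hψ' hψ't y hy
        have h2 := row_mono (b := B k) (i := k) (u := fun j => u j y) (w := fun j => w j y)
          (hoff k) (fun j _ => hwu j y) (by simp [hwj k hk])
        linarith
  have h1 := hle w hwS i x
  rw [hwi] at h1
  have h2 := le_max_right (u i x) (φ x + ε)
  simp only [] at h1
  linarith

end alg

end ErgSys

namespace ErgSys

variable {n : ℕ}

lemma HGood.bound {H : Euc n → Euc n → ℝ} (hH : HGood H) :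
    ∃ C : ℝ, 0 ≤ C ∧ (∀ x p, -C ≤ H x p) ∧ ∀ x, |H x 0| ≤ C := by
  obtain ⟨R, hR⟩ := hH.coer 0
  obtain ⟨C, hC⟩ := ((isCompact_closedBall (0 : Euc n) n).prod
    (isCompact_closedBall (0 : Euc n) (max R 0))).exists_bound_of_continuousOn
    hH.cont.continuousOn
  have key : ∀ x p, ‖p‖ ≤ max R 0 → |H x p| ≤ C := by
    intro x p hp
    obtain ⟨z, hz, h⟩ := exists_rep 0 x
    have h1 : H x p = H (x - z) p := by
      rw [← hH.per (x - z) z p hz, sub_add_cancel]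
    rw [h1]
    exact hC (x - z, p) ⟨by simpa using norm_le_of_half h, by simpa using hp⟩
  have h0 : ∀ x, |H x 0| ≤ C := fun x => key x 0 (by simp)
  have hC0 : 0 ≤ C := (abs_nonneg _).trans (h0 0)
  refine ⟨C, hC0, fun x p => ?_, h0⟩
  by_cases hp : R ≤ ‖p‖
  · have := hR p hp x
    linarith
  · exact neg_le_of_abs_le (key x p ((not_le.1 hp).le.trans (le_max_left _ _)))

lemma unif {ι : Type*} [Fintype ι] {P : ι → ℝ → Prop}
    (hmono : ∀ i a b, a ≤ b → P i a → P i b) (h : ∀ i, ∃ C : ℝ, 0 ≤ C ∧ P i C) :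
    ∃ C : ℝ, 0 ≤ C ∧ ∀ i, P i C := by
  choose C hC0 hC using h
  exact ⟨∑ i, C i, Finset.sum_nonneg fun i _ => hC0 i, fun i => hmono i _ _
    (Finset.single_le_sum (f := C) (fun j _ => hC0 j) (Finset.mem_univ i)) (hC i)⟩

section alg
variable {ι : Type*} [Fintype ι]

lemma chain {B : ι → ι → ℝ} (hoff : ∀ i j, j ≠ i → B i j ≤ 0)
    (hcon : ∀ i j, Relation.ReflTransGen (fun i j => i ≠ j ∧ B i j ≠ 0) i j) {K : ℝ}
    (hK : 0 ≤ K) : ∃ K' : ℝ, 0 ≤ K' ∧ ∀ w : ι → ℝ,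
      (∀ i, ∑ j, - B i j * (w i - w j) ≤ K) → ∀ i j, |w i - w j| ≤ K' := by
  have step : ∀ i j, ∃ D : ℝ, 0 ≤ D ∧ ∀ w : ι → ℝ,
      (∀ i, ∑ j, - B i j * (w i - w j) ≤ K) → (∀ l, w l ≤ w i) → w i - w j ≤ D := by
    intro i j
    induction hcon i j with
    | refl => exact ⟨0, le_rfl, fun w _ _ => by simp⟩
    | @tail b c _ hbc ih =>
      obtain ⟨D, hD0, hD⟩ := ih
      have ha : 0 < - B b c := by
        have := hoff b c hbc.1.symm
        have := lt_of_le_of_ne this hbc.2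
        linarith
      have hA0 : 0 ≤ ∑ j, |B b j| := Finset.sum_nonneg fun _ _ => abs_nonneg _
      refine ⟨D + (K + (∑ j, |B b j|) * D) / (- B b c), by positivity, fun w hw hm => ?_⟩
      have h1 := hD w hw hm
      have h2 : - B b c * (w b - w c) + |B b c| * D ≤
          ∑ j, (- B b j * (w b - w j) + |B b j| * D) := by
        refine Finset.single_le_sum (f := fun j => - B b j * (w b - w j) + |B b j| * D)
          (fun j _ => ?_) (Finset.mem_univ c)
        by_cases hj : j = b
        · subst hj; simp; positivity
        · have h3 := hoff b j hj
          rw [abs_of_nonpos h3]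
          have h4 := hm j
          have : 0 ≤ - B b j * (w b - w j + D) := mul_nonneg (by linarith) (by linarith)
          linarith
      rw [Finset.sum_add_distrib, ← Finset.sum_mul] at h2
      have h5 := hw b
      have h6 : 0 ≤ |B b c| * D := by positivity
      have h7 : w b - w c ≤ (K + (∑ j, |B b j|) * D) / (- B b c) := by
        rw [le_div_iff₀ ha]; linarith
      linarith
  choose D hD0 hD using step
  refine ⟨∑ i, ∑ j, D i j, Finset.sum_nonneg fun i _ => Finset.sum_nonneg fun j _ => hD0 i j, ?_⟩
  intro w hw
  have key : ∀ i j, w i - w j ≤ ∑ i, ∑ j, D i j := by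
    intro i j
    have : Nonempty ι := ⟨i⟩
    obtain ⟨k, hk⟩ := Finite.exists_max w
    have h1 := hD k j w hw hk
    have h2 : D k j ≤ ∑ j, D k j :=
      Finset.single_le_sum (f := D k) (fun j _ => hD0 k j) (Finset.mem_univ j)
    have h3 : ∑ j, D k j ≤ ∑ i, ∑ j, D i j :=
      Finset.single_le_sum (f := fun i => ∑ j, D i j)
        (fun i _ => Finset.sum_nonneg fun j _ => hD0 i j) (Finset.mem_univ k)
    linarith [hk i]
  intro i j
  rw [abs_le]
  constructor
  · linarith [key j i]
  · exact key i j

lemma sum_split (b w : ι → ℝ) (t : ℝ) :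
    ∑ j, b j * w j = (∑ j, b j) * t + ∑ j, - b j * (t - w j) := by
  rw [Finset.sum_mul, ← Finset.sum_add_distrib]
  exact Finset.sum_congr rfl fun j _ => by ring

lemma sum_abs_le (b w : ι → ℝ) (t D : ℝ) (h : ∀ j, |t - w j| ≤ D) :
    |∑ j, - b j * (t - w j)| ≤ (∑ j, |b j|) * D := by
  rw [Finset.sum_mul]
  refine (Finset.abs_sum_le_sum_abs _ _).trans (Finset.sum_le_sum fun j _ => ?_)
  rw [abs_mul, abs_neg]
  exact mul_le_mul_of_nonneg_left (h j) (abs_nonneg _)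

theorem est [DecidableEq ι] {B : ι → ι → ℝ} (hoff : ∀ i j, j ≠ i → B i j ≤ 0)
    (hrow : ∀ i, 0 ≤ ∑ j, B i j)
    (hcon : ∀ i j, Relation.ReflTransGen (fun i j => i ≠ j ∧ B i j ≠ 0) i j)
    {H : ι → Euc n → Euc n → ℝ} (hH : ∀ i, HGood (H i)) :
    ∃ K R : ℝ, 0 ≤ K ∧ 0 ≤ R ∧ ∀ lam : ℝ, 0 < lam → ∃ u : ι → Euc n → ℝ, CP u ∧
      (∀ (i : ι) (ψ : Euc n → ℝ), ContDiff ℝ 1 ψ → TorusFun ψ → ∀ x : Euc n,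
        IsLocalMax (fun y => u i y - ψ y) x →
          lam * u i x + (∑ j, B i j * u j x) + H i x (gradient ψ x) ≤ 0) ∧
      (∀ (i : ι) (ψ : Euc n → ℝ), ContDiff ℝ 1 ψ → TorusFun ψ → ∀ x : Euc n,
        IsLocalMin (fun y => u i y - ψ y) x →
          0 ≤ lam * u i x + (∑ j, B i j * u j x) + H i x (gradient ψ x)) ∧
      (∀ i x, |lam * u i x| ≤ K) ∧ (∀ i x, |∑ j, B i j * u j x| ≤ K) ∧
      ∀ i x y, u i y - u i x ≤ R * ‖y - x‖ := by
  obtain ⟨C, hC0, hC⟩ := unif (P := fun i C => (∀ x p, -C ≤ H i x p) ∧ ∀ x, |H i x 0| ≤ C)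
    (fun i a b hab h => ⟨fun x p => by linarith [h.1 x p], fun x => (h.2 x).trans hab⟩)
    (fun i => (hH i).bound)
  obtain ⟨D, hD0, hD⟩ := chain hoff hcon (K := 2 * C) (by positivity)
  have hA0 : ∀ i, 0 ≤ ∑ j, |B i j| := fun i => Finset.sum_nonneg fun _ _ => abs_nonneg _
  obtain ⟨A, hAn, hA⟩ := unif (P := fun i a => ∑ j, |B i j| ≤ a)
    (fun i a b hab h => h.trans hab) (fun i => ⟨_, hA0 i, le_rfl⟩)
  obtain ⟨D2, hD20, hD2⟩ := chain hoff hcon (K := 2 * C + (2 * C + A * D)) (by positivity)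
  set K := 2 * C + A * D + A * D2 with hKdef
  have hAD : 0 ≤ A * D := by positivity
  have hAD2 : 0 ≤ A * D2 := by positivity
  obtain ⟨R, hR0, hR⟩ := unif (P := fun i R => ∀ u : Euc n → ℝ, Continuous u → TorusFun u →
      (∀ ψ : Euc n → ℝ, ContDiff ℝ 1 ψ → TorusFun ψ → ∀ x,
        IsLocalMax (fun y => u y - ψ y) x → H i x (gradient ψ x) ≤ C + K) →
      ∀ x y, u y - u x ≤ R * ‖y - x‖)
    (fun i a b hab h u hu hut hs x y => (h u hu hut hs x y).trans
      (mul_le_mul_of_nonneg_right hab (norm_nonneg _)))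
    (fun i => by
      obtain ⟨R, h0, h⟩ := (hH i).lip (C + K)
      exact ⟨R, h0.le, h⟩)
  refine ⟨K, R, by positivity, hR0, fun lam hl => ?_⟩
  have hsum : ∀ i (w : ι → ℝ), ∑ j, (B i j + if j = i then lam else 0) * w j
      = lam * w i + ∑ j, B i j * w j := by
    intro i w
    simp [add_mul, Finset.sum_add_distrib, add_comm]
  obtain ⟨u, hu, hsub, hsup, hbd⟩ := perron (B := fun i j => B i j + if j = i then lam else 0)
    (fun i j hj => by simpa [hj] using hoff i j hj) hl
    (fun i => by simpa [Finset.sum_add_distrib] using hrow i) hH hC0 (fun i => (hC i).2)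
  have hsub' : ∀ (i : ι) (ψ : Euc n → ℝ), ContDiff ℝ 1 ψ → TorusFun ψ → ∀ x : Euc n,
        IsLocalMax (fun y => u i y - ψ y) x →
          lam * u i x + (∑ j, B i j * u j x) + H i x (gradient ψ x) ≤ 0 := by
    intro i ψ h1 h2 x h3
    have := hsub i ψ h1 h2 x h3
    rwa [hsum i (fun j => u j x)] at this
  have hsup' : ∀ (i : ι) (ψ : Euc n → ℝ), ContDiff ℝ 1 ψ → TorusFun ψ → ∀ x : Euc n,
        IsLocalMin (fun y => u i y - ψ y) x →
          0 ≤ lam * u i x + (∑ j, B i j * u j x) + H i x (gradient ψ x) := by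
    intro i ψ h1 h2 x h3
    have := hsup i ψ h1 h2 x h3
    rwa [hsum i (fun j => u j x)] at this
  have hlu : ∀ i x, |lam * u i x| ≤ C := by
    intro i x
    rw [abs_mul, abs_of_pos hl]
    have := hbd i x
    rw [le_div_iff₀ hl] at this
    linarith
  have hup : ∀ i x, lam * u i x + ∑ j, B i j * u j x ≤ C := by
    intro i x
    refine dense_bound (hu i).1 (hu i).2 (T := fun x => lam * u i x + ∑ j, B i j * u j x)
      (((hu i).1.const_mul _).add
        (continuous_finsetSum _ fun j _ => (hu j).1.const_mul _)) (fun ψ h1 h2 x h3 => ?_) x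
    have := hsub' i ψ h1 h2 x h3
    have := (hC i).1 x (gradient ψ x)
    linarith
  choose X hX using fun i => exists_min (hu i).1 (hu i).2
  have hm : ∀ i, -(2 * C) ≤ ∑ j, B i j * u j (X j) := by
    intro i
    have h1 := hsup' i (fun _ => 0) contDiff_const (fun _ _ _ => rfl) (X i)
      (Filter.Eventually.of_forall fun y => by simpa using hX i y)
    rw [gradient_fun_const] at h1
    have h2 : ∑ j, B i j * u j (X i) ≤ ∑ j, B i j * u j (X j) :=
      row_mono (i := i) (hoff i) (fun j _ => hX j _) rfl
    have h3 := le_of_abs_le (hlu i (X i))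
    have h4 := le_of_abs_le ((hC i).2 (X i))
    linarith
  set w : ι → ℝ := fun i => max (- u i (X i)) 0 with hwdef
  have hw0 : ∀ i, 0 ≤ w i := fun i => le_max_right _ _
  have hw1 : ∀ i, - u i (X i) ≤ w i := fun i => le_max_left _ _
  have hBw : ∀ i, ∑ j, B i j * w j ≤ 2 * C := by
    intro i
    by_cases h : 0 ≤ - u i (X i)
    · have h1 : ∑ j, B i j * w j ≤ ∑ j, B i j * (- u j (X j)) :=
        row_mono (i := i) (hoff i) (fun j _ => hw1 j) (max_eq_left h).symm
      simp only [mul_neg, Finset.sum_neg_distrib] at h1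
      linarith [hm i]
    · have h1 : ∑ j, B i j * w j ≤ ∑ j, B i j * 0 :=
        row_mono (i := i) (u := fun _ => 0) (hoff i) (fun j _ => hw0 j)
          (max_eq_right (not_le.1 h).le).symm
      simp only [mul_zero, Finset.sum_const_zero] at h1
      linarith
  have hDw := hD w (fun i => by
    have h1 := sum_split (B i) w (w i)
    have h2 := mul_nonneg (hrow i) (hw0 i)
    linarith [hBw i])
  have hlow : ∀ i x, -(2 * C + A * D) ≤ (∑ j, B i j) * u i x := by
    intro i x
    have h1 := sum_split (B i) w (w i)
    have h2 := neg_le_of_abs_le (sum_abs_le (B i) w (w i) D (hDw i))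
    have h3 : (∑ j, |B i j|) * D ≤ A * D := mul_le_mul_of_nonneg_right (hA i) hD0
    have h4 : (∑ j, B i j) * (- w i) ≤ (∑ j, B i j) * u i x :=
      mul_le_mul_of_nonneg_left (by linarith [hw1 i, hX i x]) (hrow i)
    have := hBw i
    linarith
  have hDu : ∀ x i j, |u i x - u j x| ≤ D2 := by
    intro x
    refine hD2 (fun i => u i x) (fun i => ?_)
    have h1 := sum_split (B i) (fun j => u j x) (u i x)
    have h2 := neg_le_of_abs_le (hlu i x)
    have h3 := hup i x
    have h4 := hlow i x
    linarith
  have hBu : ∀ i x, |∑ j, B i j * u j x| ≤ K := by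
    intro i x
    have h1 := sum_split (B i) (fun j => u j x) (u i x)
    have h2 := neg_le_of_abs_le (sum_abs_le (B i) (fun j => u j x) (u i x) D2 (hDu x i))
    have h3 : (∑ j, |B i j|) * D2 ≤ A * D2 := mul_le_mul_of_nonneg_right (hA i) hD20
    have h4 := hlow i x
    have h5 := hup i x
    have h6 := neg_le_of_abs_le (hlu i x)
    rw [abs_le]
    constructor
    · rw [h1]
      linarith
    · linarith
  refine ⟨u, hu, hsub', hsup', fun i x => (hlu i x).trans (by linarith), hBu, fun i =>
    hR i (u i) (hu i).1 (hu i).2 fun ψ h1 h2 x h3 => ?_⟩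
  have h4 := hsub' i ψ h1 h2 x h3
  have h5 := neg_le_of_abs_le (hBu i x)
  have h6 := neg_le_of_abs_le (hlu i x)
  linarith

end alg

end ErgSys

namespace ErgSys

variable {n : ℕ}

lemma ulim (F : Ultrafilter ℕ) {f : ℕ → ℝ} {C : ℝ} (h : ∀ k, |f k| ≤ C) :
    ∃ l, Tendsto f F (𝓝 l) := by
  obtain ⟨l, -, hl⟩ := (isCompact_Icc (a := -C) (b := C)).ultrafilter_le_nhds
    (F.map f) (by
      rw [Ultrafilter.coe_map, Filter.le_principal_iff, Filter.mem_map]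
      exact Filter.univ_mem' fun k => abs_le.1 (h k))
  exact ⟨l, hl⟩

lemma unif_conv {F : Filter ℕ} {w : ℕ → Euc n → ℝ} {v : Euc n → ℝ} {R : ℝ} (hR : 0 ≤ R)
    (hw : ∀ k, TorusFun (w k)) (hwl : ∀ k x y, w k y - w k x ≤ R * ‖y - x‖)
    (hv : TorusFun v) (hvl : ∀ x y, v y - v x ≤ R * ‖y - x‖)
    (hlim : ∀ x, Tendsto (fun k => w k x) F (𝓝 (v x))) {ε : ℝ} (hε : 0 < ε) :
    ∀ᶠ k in F, ∀ x, |w k x - v x| ≤ ε := by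
  set δ := ε / 3 / (R + 1) with hδ
  have hδ0 : 0 < δ := by positivity
  have hRδ : R * δ ≤ ε / 3 := by
    have : (R + 1) * δ = ε / 3 := by rw [hδ]; field_simp
    nlinarith
  obtain ⟨t, -, htf, htc⟩ := (isCompact_closedBall (0 : Euc n) n).finite_cover_balls hδ0
  have h1 : ∀ᶠ k in F, ∀ y ∈ t, |w k y - v y| < ε / 3 := by
    rw [Filter.eventually_all_finite htf]
    intro y _
    have := Metric.tendsto_nhds.1 (hlim y) (ε / 3) (by positivity)
    simpa [Real.dist_eq] using this
  filter_upwards [h1] with k hk x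
  obtain ⟨z, hz, h⟩ := exists_rep 0 x
  rw [← (hw k).sub_int x z hz, ← hv.sub_int x z hz]
  have hx : x - z ∈ Metric.closedBall (0 : Euc n) n := by simpa using norm_le_of_half h
  obtain ⟨y, hy, hxy⟩ := Set.mem_iUnion₂.1 (htc hx)
  rw [Metric.mem_ball, dist_eq_norm] at hxy
  have h2 := hwl k y (x - z)
  have h3 := hwl k (x - z) y
  have h4 := hvl y (x - z)
  have h5 := hvl (x - z) y
  rw [norm_sub_rev] at h3 h5
  have h6 : R * ‖x - z - y‖ ≤ ε / 3 := (mul_le_mul_of_nonneg_left hxy.le hR).trans hRδ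
  have h7 := abs_lt.1 (hk y hy)
  rw [abs_le]
  constructor <;> linarith [h7.1, h7.2]

theorem irred {ι : Type*} [Fintype ι] [DecidableEq ι] {B : ι → ι → ℝ}
    (hoff : ∀ i j, j ≠ i → B i j ≤ 0) (hrow : ∀ i, 0 ≤ ∑ j, B i j)
    (hcon : ∀ i j, Relation.ReflTransGen (fun i j => i ≠ j ∧ B i j ≠ 0) i j)
    {H : ι → Euc n → Euc n → ℝ} (hH : ∀ i, HGood (H i)) :
    ∃ (c : ι → ℝ) (v : ι → Euc n → ℝ), CP v ∧ SubS B H c v ∧ SupS B H c v := by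
  obtain ⟨K, R, hK, hR, hest⟩ := est hoff hrow hcon hH
  have hlam : ∀ k : ℕ, (0 : ℝ) < 1 / ((k : ℝ) + 1) := fun k => by positivity
  choose u hu hsub hsup hlu hBu hlip using fun k : ℕ => hest _ (hlam k)
  set F : Ultrafilter ℕ := hyperfilter ℕ with hF
  have hlam0 : Tendsto (fun k : ℕ => 1 / ((k : ℝ) + 1)) F (𝓝 0) :=
    tendsto_one_div_add_atTop_nhds_zero_nat.mono_left Nat.hyperfilter_le_atTop
  set w : ℕ → ι → Euc n → ℝ := fun k i x => u k i x - u k i 0 with hw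
  have hwt : ∀ k i, TorusFun (w k i) := fun k i x z hz => by
    simp only [hw, (hu k i).2 x z hz]
  have hwc : ∀ k i, Continuous (w k i) := fun k i => (hu k i).1.sub continuous_const
  have hwl : ∀ k i x y, w k i y - w k i x ≤ R * ‖y - x‖ := fun k i x y => by
    have := hlip k i x y
    simp only [hw]; linarith
  have hwb : ∀ k i x, |w k i x| ≤ R * n := by
    intro k i x
    obtain ⟨z, hz, h⟩ := exists_rep 0 x
    rw [← (hwt k i).sub_int x z hz]
    have h1 := hlip k i 0 (x - z)
    have h2 := hlip k i (x - z) 0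
    rw [norm_sub_rev] at h2
    have h3 : ‖x - z - 0‖ ≤ n := by
      have := norm_le_of_half h
      simpa using this
    have h4 := mul_le_mul_of_nonneg_left h3 hR
    simp only [hw]
    rw [abs_le]
    constructor <;> linarith
  set d : ℕ → ι → ℝ := fun k i =>
    -(1 / ((k : ℝ) + 1) * u k i 0) - ∑ j, B i j * u k j 0 with hd
  have hdb : ∀ k i, |d k i| ≤ 2 * K := by
    intro k i
    have h1 := abs_le.1 (hlu k i 0)
    have h2 := abs_le.1 (hBu k i 0)
    simp only [hd]
    rw [abs_le]
    constructor <;> linarith [h1.1, h1.2, h2.1, h2.2]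
  choose v hv using fun i x => ulim F (f := fun k => w k i x) (fun k => hwb k i x)
  choose c hc using fun i => ulim F (f := fun k => d k i) (fun k => hdb k i)
  have hvl : ∀ i x y, v i y - v i x ≤ R * ‖y - x‖ := fun i x y =>
    le_of_tendsto' ((hv i y).sub (hv i x)) fun k => hwl k i x y
  have hvt : ∀ i, TorusFun (v i) := fun i x z hz =>
    tendsto_nhds_unique (hv i (x + z)) (by
      have : (fun k => w k i (x + z)) = fun k => w k i x := funext fun k => hwt k i x z hz
      rw [this]; exact hv i x)
  have hvc : ∀ i, Continuous (v i) := fun i => cont_of_lip hR (hvl i)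
  have hconv : ∀ ε > 0, ∀ᶠ k in (F : Filter ℕ), ∀ i x, |w k i x - v i x| ≤ ε := by
    intro ε hε
    rw [Filter.eventually_all]
    intro i
    exact unif_conv hR (fun k => hwt k i) (fun k => hwl k i) (hvt i) (hvl i) (hv i) hε
  have hT : ∀ i, Continuous fun y => ∑ j, B i j * v j y - c i := fun i =>
    (continuous_finsetSum _ fun j _ => (hvc j).const_mul _).sub continuous_const
  have hmain : ∀ i, ∀ ε > 0, ∃ k, (∀ y, |w k i y - v i y| ≤ ε) ∧
      ∀ y, |(1 / ((k : ℝ) + 1) * u k i y + ∑ j, B i j * u k j y) -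
        (∑ j, B i j * v j y - c i)| ≤ ε := by
    intro i ε hε
    set A := ∑ j, |B i j| with hA
    have hA0 : 0 ≤ A := Finset.sum_nonneg fun _ _ => abs_nonneg _
    have e1 := hconv (min ε (ε / 3 / (A + 1))) (by positivity)
    have e2 := Metric.tendsto_nhds.1 (hc i) (ε / 3) (by positivity)
    have e3 := Metric.tendsto_nhds.1 hlam0 (ε / 3 / (R * n + 1)) (by positivity)
    obtain ⟨k, h1, h2, h3⟩ := (e1.and (e2.and e3)).exists
    refine ⟨k, fun y => (h1 i y).trans (min_le_left _ _), fun y => ?_⟩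
    rw [Real.dist_eq] at h2 h3
    rw [sub_zero, abs_of_pos (hlam k)] at h3
    have h4 : |∑ j, B i j * (w k j y - v j y)| ≤ ε / 3 := by
      refine (Finset.abs_sum_le_sum_abs _ _).trans ?_
      have : ∑ j, |B i j * (w k j y - v j y)| ≤ A * (ε / 3 / (A + 1)) := by
        rw [hA, Finset.sum_mul]
        refine Finset.sum_le_sum fun j _ => ?_
        rw [abs_mul]
        exact mul_le_mul_of_nonneg_left ((h1 j y).trans (min_le_right _ _)) (abs_nonneg _)
      have h5 : (A + 1) * (ε / 3 / (A + 1)) = ε / 3 := by field_simp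
      have h6 : 0 < ε / 3 / (A + 1) := by positivity
      nlinarith
    have h5 : |1 / ((k : ℝ) + 1) * w k i y| ≤ ε / 3 := by
      rw [abs_mul, abs_of_pos (hlam k)]
      have h6 : (R * n + 1) * (ε / 3 / (R * n + 1)) = ε / 3 := by field_simp
      have h7 := mul_le_mul h3.le (hwb k i y) (abs_nonneg _) (by positivity)
      have h8 : 0 < ε / 3 / (R * n + 1) := by positivity
      nlinarith
    have h6 : (1 / ((k : ℝ) + 1) * u k i y + ∑ j, B i j * u k j y) -
        (∑ j, B i j * v j y - c i) = 1 / ((k : ℝ) + 1) * w k i y +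
          ∑ j, B i j * (w k j y - v j y) - (d k i - c i) := by
      simp only [hw, hd, mul_sub, Finset.sum_sub_distrib]
      ring
    rw [h6]
    have h7 := abs_le.1 h4
    have h8 := abs_le.1 h5
    have h9 := abs_lt.1 h2
    rw [abs_le]
    constructor <;> linarith [h7.1, h7.2, h8.1, h8.2, h9.1, h9.2]
  have hshift : ∀ k i (φ : Euc n → ℝ), (fun y => u k i y - φ y) =
      fun y => (w k i y - φ y) + u k i 0 := by
    intro k i φ
    funext y
    simp only [hw]; ring
  refine ⟨c, v, fun i => ⟨hvc i, hvt i⟩, ?_, ?_⟩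
  · intro i ψ h1 h2 x h3
    have := sub_core (hH i).cont (hT i) 0 (hvc i) (hvt i) h1 h2 h3 (fun ε hε => by
      obtain ⟨k, hk1, hk2⟩ := hmain i ε hε
      refine ⟨w k i, hwc k i, hwt k i, fun y => by linarith [(abs_le.1 (hk1 y)).2],
        by linarith [(abs_le.1 (hk1 x)).1], fun φ p1 p2 y p3 => ?_⟩
      have p4 := hsub k i φ p1 p2 y (by
        rw [hshift]
        filter_upwards [p3] with z hz
        linarith)
      have p5 := (abs_le.1 (hk2 y)).1
      linarith)
    linarith
  · intro i ψ h1 h2 x h3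
    have := sup_core (hH i).cont (hT i) 0 (hvc i) (hvt i) h1 h2 h3 (fun ε hε => by
      obtain ⟨k, hk1, hk2⟩ := hmain i ε hε
      refine ⟨w k i, hwc k i, hwt k i, fun y => by linarith [(abs_le.1 (hk1 y)).1],
        by linarith [(abs_le.1 (hk1 x)).2], fun φ p1 p2 y p3 => ?_⟩
      have p4 := hsup k i φ p1 p2 y (by
        rw [hshift]
        filter_upwards [p3] with z hz
        linarith)
      have p5 := (abs_le.1 (hk2 y)).2
      linarith)
    linarith

end ErgSys

namespace ErgSys

variable {n : ℕ}

lemma HGood.add {H : Euc n → Euc n → ℝ} (hH : HGood H) {f : Euc n → ℝ} (hf : Continuous f)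
    (hft : TorusFun f) : HGood fun x p => H x p + f x := by
  refine ⟨hH.cont.add (hf.comp continuous_fst), fun x z p hz => ?_, fun M => ?_⟩
  · rw [hH.per x z p hz, hft x z hz]
  · obtain ⟨x0, h0⟩ := exists_min hf hft
    obtain ⟨R, hR⟩ := hH.coer (M - f x0)
    exact ⟨R, fun p hp x => by linarith [hR p hp x, h0 x]⟩

theorem general : ∀ (N : ℕ) (ι : Type) [Fintype ι], Fintype.card ι = N →
    ∀ (B : ι → ι → ℝ), (∀ i j, j ≠ i → B i j ≤ 0) → (∀ i, 0 ≤ ∑ j, B i j) →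
    ∀ (H : ι → Euc n → Euc n → ℝ), (∀ i, HGood (H i)) →
    ∃ (c : ι → ℝ) (v : ι → Euc n → ℝ), CP v ∧ SubS B H c v ∧ SupS B H c v := by
  classical
  intro N
  induction N using Nat.strong_induction_on with
  | _ N ih =>
  intro ι _ hN B hoff hrow H hH
  by_cases hcon : ∀ i j, Relation.ReflTransGen (fun i j => i ≠ j ∧ B i j ≠ 0) i j
  · exact irred hoff hrow hcon hH
  push Not at hcon
  obtain ⟨a, b, hab⟩ := hcon
  set P : ι → Prop := fun k => Relation.ReflTransGen (fun i j => i ≠ j ∧ B i j ≠ 0) a k with hP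
  have hPa : P a := Relation.ReflTransGen.refl
  have hPb : ¬ P b := hab
  have hcl : ∀ i j, P i → ¬ P j → B i j = 0 := by
    intro i j hi hj
    by_contra hne
    exact hj (hi.tail ⟨fun h => hj (h ▸ hi), hne⟩)
  have hspl : ∀ f : ι → ℝ, ∑ j : {x // P x}, f j + ∑ j : {x // ¬ P x}, f j = ∑ j, f j :=
    fun f => Fintype.sum_subtype_add_sum_subtype P f
  have hz : ∀ i, P i → ∀ f : ι → ℝ, ∑ j : {x // ¬ P x}, B i j * f j = 0 := fun i hi f =>
    Finset.sum_eq_zero fun j _ => by rw [hcl i j hi j.2, zero_mul]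
  obtain ⟨c1, v1, hv1, hsub1, hsup1⟩ := ih (Fintype.card {x // P x})
    (hN ▸ Fintype.card_subtype_lt (x := b) hPb) {x // P x} rfl (fun i j => B i j)
    (fun i j hij => hoff i j fun h => hij (Subtype.ext h))
    (fun i => by
      have h1 := hspl (fun j => B i j)
      have h2 := hz i i.2 (fun _ => 1)
      simp only [mul_one] at h2
      rw [h2, add_zero] at h1
      rw [h1]; exact hrow i) (fun i => H i) (fun i => hH i)
  obtain ⟨c2, v2, hv2, hsub2, hsup2⟩ := ih (Fintype.card {x // ¬ P x})
    (hN ▸ Fintype.card_subtype_lt (x := a) (not_not.2 hPa)) {x // ¬ P x} rfl (fun i j => B i j)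
    (fun i j hij => hoff i j fun h => hij (Subtype.ext h))
    (fun i => by
      have h1 := hspl (fun j => B i j)
      have h2 : ∑ j : {x // P x}, B i j ≤ 0 :=
        Finset.sum_nonpos fun j _ => hoff i j fun h => i.2 (h ▸ j.2)
      linarith [hrow i])
    (fun i x p => H i x p + ∑ j : {x // P x}, B i j * v1 j x)
    (fun i => (hH i).add (continuous_finsetSum _ fun j _ => (hv1 j).1.const_mul _)
      fun x z hz => Finset.sum_congr rfl fun j _ => by rw [(hv1 j).2 x z hz])
  set v : ι → Euc n → ℝ := fun i => if h : P i then v1 ⟨i, h⟩ else v2 ⟨i, h⟩ with hv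
  set c : ι → ℝ := fun i => if h : P i then c1 ⟨i, h⟩ else c2 ⟨i, h⟩ with hc
  have hvP : ∀ j : {x // P x}, v j = v1 j := fun j => by simp only [hv, dif_pos j.2]
  have hvN : ∀ j : {x // ¬ P x}, v j = v2 j := fun j => by simp only [hv, dif_neg j.2]
  have hcP : ∀ j : {x // P x}, c j = c1 j := fun j => by simp only [hc, dif_pos j.2]
  have hcN : ∀ j : {x // ¬ P x}, c j = c2 j := fun j => by simp only [hc, dif_neg j.2]
  have hsP : ∀ (i : {x // P x}) x, ∑ j, B i j * v j x = ∑ j : {x // P x}, B i j * v1 j x := by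
    intro i x
    rw [← hspl, hz i i.2 (fun j => v j x), add_zero]
    exact Finset.sum_congr rfl fun j _ => by rw [hvP]
  have hsN : ∀ (i : {x // ¬ P x}) x, ∑ j, B i j * v j x =
      ∑ j : {x // P x}, B i j * v1 j x + ∑ j : {x // ¬ P x}, B i j * v2 j x := by
    intro i x
    rw [← hspl]
    congr 1
    · exact Finset.sum_congr rfl fun j _ => by rw [hvP]
    · exact Finset.sum_congr rfl fun j _ => by rw [hvN]
  refine ⟨c, v, fun i => ?_, fun i ψ h1 h2 x h3 => ?_, fun i ψ h1 h2 x h3 => ?_⟩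
  · by_cases h : P i
    · exact (hvP ⟨i, h⟩) ▸ hv1 ⟨i, h⟩
    · exact (hvN ⟨i, h⟩) ▸ hv2 ⟨i, h⟩
  · by_cases h : P i
    · have e1 := hvP ⟨i, h⟩
      have e2 := hcP ⟨i, h⟩
      have e3 := hsP ⟨i, h⟩ x
      simp only at e1 e2 e3
      rw [e1] at h3
      rw [e2, e3]
      exact hsub1 ⟨i, h⟩ ψ h1 h2 x h3
    · have e1 := hvN ⟨i, h⟩
      have e2 := hcN ⟨i, h⟩
      have e3 := hsN ⟨i, h⟩ x
      simp only at e1 e2 e3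
      rw [e1] at h3
      rw [e2, e3]
      have := hsub2 ⟨i, h⟩ ψ h1 h2 x h3
      simp only at this
      linarith
  · by_cases h : P i
    · have e1 := hvP ⟨i, h⟩
      have e2 := hcP ⟨i, h⟩
      have e3 := hsP ⟨i, h⟩ x
      simp only at e1 e2 e3
      rw [e1] at h3
      rw [e2, e3]
      exact hsup1 ⟨i, h⟩ ψ h1 h2 x h3
    · have e1 := hvN ⟨i, h⟩
      have e2 := hcN ⟨i, h⟩
      have e3 := hsN ⟨i, h⟩ x
      simp only at e1 e2 e3
      rw [e1] at h3
      rw [e2, e3]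
      have := hsup2 ⟨i, h⟩ ψ h1 h2 x h3
      simp only at this
      linarith

lemma ham_good {m : ℕ} {Ξ : Type*} [MetricSpace Ξ] [CompactSpace Ξ]
    {g : Fin m → Euc n × Ξ → Euc n} {L : Fin m → Euc n × Ξ → ℝ}
    (hgL : GoodData g L) (hcoer : Coercive g L) (i : Fin m) : HGood (ham g L i) := by
  refine ⟨?_, fun x z p hz => ?_, hcoer i⟩
  · have hc : Continuous fun r : (Euc n × Euc n) × Ξ =>
        (-⟪g i (r.1.1, r.2), r.1.2⟫ - L i (r.1.1, r.2)) := by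
      have h1 := (hgL.1 i).1
      have h2 := (hgL.2 i).1
      fun_prop
    have := IsCompact.continuous_sSup (K := (Set.univ : Set Ξ)) (f := fun (q : Euc n × Euc n) ξ =>
      (-⟪g i (q.1, ξ), q.2⟫ - L i (q.1, ξ))) isCompact_univ hc
    simp only [Set.image_univ, sSup_range] at this
    exact this
  · unfold ham
    congr 1
    funext ξ
    rw [(hgL.1 i).2 x z ξ hz, (hgL.2 i).2 x z ξ hz]

end ErgSys

theorem stmt16 {n m : ℕ} (hn : 0 < n) (hm : 0 < m)
    {Ξ : Type*} [MetricSpace Ξ] [CompactSpace Ξ] [Nonempty Ξ]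
    (g : Fin m → Euc n × Ξ → Euc n) (L : Fin m → Euc n × Ξ → ℝ)
    (hgL : GoodData g L) (hcoer : Coercive g L)
    (B : Matrix (Fin m) (Fin m) ℝ) (hB : IsMonotoneMat B) :
    ∃ (c : Fin m → ℝ) (v : Fin m → Euc n → ℝ),
      IsSol (fun _ => B) 0 g L c v := by
  have hrow : ∀ i, 0 ≤ ∑ j, B i j := fun i => by
    simpa using hB (fun _ => 1) i (fun _ => le_rfl) zero_le_one
  have hoff : ∀ i j, j ≠ i → B i j ≤ 0 := fun i j hij => by
    have h := hB (fun k => if k = j then -1 else 0) i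
      (fun k => by simp only [hij.symm, if_false]; split_ifs <;> norm_num)
      (by simp [hij.symm])
    simpa using h
  obtain ⟨c, v, hv, hsub, hsup⟩ := ErgSys.general (n := n) m (Fin m) (Fintype.card_fin m)
    (fun i j => B i j) hoff hrow (fun i => ham g L i) (fun i => ErgSys.ham_good hgL hcoer i)
  refine ⟨c, v, fun i => (hv i).1, ⟨fun i => ⟨(hv i).1.upperSemicontinuous, (hv i).2⟩, ?_⟩,
    ⟨fun i => ⟨(hv i).1.lowerSemicontinuous, (hv i).2⟩, ?_⟩⟩
  · intro i ψ h1 h2 x h3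
    rw [zero_mul, zero_add]
    exact hsub i ψ h1 h2 x h3
  · intro i ψ h1 h2 x h3
    rw [zero_mul, zero_add]
    exact hsup i ψ h1 h2 x h3
end

section
/- Assume the coercivity condition (C) and that B = diag(b_1,…,b_m) is a constant diagonal m×m matrix with b_i ≥ 0 for every i ∈ 𝕀. Then there exist c = (c_i)_{i∈𝕀} ∈ ℝᵐ and v = (v_i)_{i∈𝕀} with each v_i Lipschitz continuous on 𝕋ⁿ such that the pair (c,v) solves the ergodic problem, i.e. for each i ∈ 𝕀 the function v_i is a viscosity solution of b_i v_i + H_i(x, Dv_i) = c_i in 𝕋ⁿ. -/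
open MeasureTheory Filter Topology RealInnerProductSpace

/-- Discounted semi-Lagrangian scheme: existence of a periodic fixed point. -/
lemma exists_discrete {n : ℕ} {X : Type*} [Nonempty X] (g : Euc n × X → Euc n)
    (L : Euc n × X → ℝ) (hgp : TorusFun2 g) (hLp : TorusFun2 L) (C : ℝ) (hC : ∀ q, |L q| ≤ C)
    (lam h : ℝ) (hlam : 0 < lam) (hh : 0 < h) (hlh : lam * h ≤ 1) :
    ∃ u : Euc n → ℝ, TorusFun u ∧ (∀ x, lam * |u x| ≤ C) ∧
      (∀ x ξ, u x ≤ (1 - lam * h) * u (x + h • g (x, ξ)) + h * L (x, ξ)) ∧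
      (∀ x ε, 0 < ε → ∃ ξ, (1 - lam * h) * u (x + h • g (x, ξ)) + h * L (x, ξ) < u x + ε) := by
  obtain ⟨ξ0⟩ := ‹Nonempty X›
  have hC0 : 0 ≤ C := (abs_nonneg _).trans (hC (0, ξ0))
  set M : ℝ := C / lam with hM
  have hM0 : 0 ≤ M := by positivity
  have hlM : lam * M = C := by rw [hM]; field_simp
  have : Fact (-M ≤ M) := ⟨by linarith⟩
  have : Nonempty X := ⟨ξ0⟩
  have hlow : ∀ (u : Euc n → Set.Icc (-M) M) x ξ,
      -M ≤ (1 - lam * h) * (u (x + h • g (x, ξ)) : ℝ) + h * L (x, ξ) := by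
    intro u x ξ
    have h1 := (u (x + h • g (x, ξ))).2.1
    have h2 := (abs_le.1 (hC (x, ξ))).1
    nlinarith [mul_le_mul_of_nonneg_left h1 (sub_nonneg.2 hlh), mul_le_mul_of_nonneg_left h2 hh.le]
  have hup : ∀ (u : Euc n → Set.Icc (-M) M) x ξ,
      (1 - lam * h) * (u (x + h • g (x, ξ)) : ℝ) + h * L (x, ξ) ≤ M := by
    intro u x ξ
    have h1 := (u (x + h • g (x, ξ))).2.2
    have h2 := (abs_le.1 (hC (x, ξ))).2
    nlinarith [mul_le_mul_of_nonneg_left h1 (sub_nonneg.2 hlh), mul_le_mul_of_nonneg_left h2 hh.le]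
  have hbdd : ∀ (u : Euc n → Set.Icc (-M) M) x, BddBelow (Set.range fun ξ =>
      (1 - lam * h) * (u (x + h • g (x, ξ)) : ℝ) + h * L (x, ξ)) := by
    rintro u x
    exact ⟨-M, by rintro _ ⟨ξ, rfl⟩; exact hlow u x ξ⟩
  let T : (Euc n → Set.Icc (-M) M) →o (Euc n → Set.Icc (-M) M) :=
    { toFun := fun u x => ⟨⨅ ξ, ((1 - lam * h) * (u (x + h • g (x, ξ)) : ℝ) + h * L (x, ξ)),
        le_ciInf (hlow u x), (ciInf_le (hbdd u x) ξ0).trans (hup u x ξ0)⟩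
      monotone' := by
        intro u v huv x
        refine Subtype.coe_le_coe.1 (ciInf_mono (hbdd u x) fun ξ => ?_)
        have : (u (x + h • g (x, ξ)) : ℝ) ≤ v (x + h • g (x, ξ)) := huv _
        have := mul_le_mul_of_nonneg_left this (sub_nonneg.2 hlh)
        linarith }
  have hTval : ∀ u x, (T u x : ℝ) =
    ⨅ ξ, ((1 - lam * h) * (u (x + h • g (x, ξ)) : ℝ) + h * L (x, ξ)) := fun _ _ => rfl
  have hfix : T T.lfp = T.lfp := T.map_lfp
  have hfx : ∀ x, (T.lfp x : ℝ) =
      ⨅ ξ, ((1 - lam * h) * (T.lfp (x + h • g (x, ξ)) : ℝ) + h * L (x, ξ)) := by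
    intro x
    rw [← hTval, hfix]
  have hshift : ∀ z : Euc n, IsIntVec z → ∀ x, (T.lfp x : ℝ) ≤ T.lfp (x + z) := by
    intro z hz x
    have : T.lfp ≤ fun x => T.lfp (x + z) := by
      apply T.lfp_le_fixed
      funext x
      apply Subtype.ext
      rw [hTval, hfx (x + z)]
      congr 1
      funext ξ
      rw [hgp x z ξ hz, hLp x z ξ hz, add_right_comm]
    exact this x
  refine ⟨fun x => T.lfp x, ?_, ?_, ?_, ?_⟩
  · intro x z hz
    apply le_antisymm _ (hshift z hz x)
    have hz' : IsIntVec (-z) := fun i => by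
      obtain ⟨k, hk⟩ := hz i
      exact ⟨-k, by simp [hk]⟩
    have := hshift (-z) hz' (x + z)
    simpa using this
  · intro x
    rw [← hlM]
    exact mul_le_mul_of_nonneg_left (abs_le.2 (T.lfp x).2) hlam.le
  · intro x ξ
    show (T.lfp x : ℝ) ≤ _
    rw [hfx x]
    exact ciInf_le (hbdd _ x) ξ
  · intro x ε hε
    apply exists_lt_of_ciInf_lt
    show _ < (T.lfp x : ℝ) + ε
    rw [← hfx x]; linarith

lemma asymp_lip {n : ℕ} (u : Euc n → ℝ) (δ D : ℝ) (hδ : 0 < δ) (hD : 0 ≤ D)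
    (hu : ∀ x y, ‖x - y‖ ≤ δ → u x ≤ u y + D) (x y : Euc n) :
    |u x - u y| ≤ D / δ * ‖x - y‖ + D := by
  have key : ∀ (N : ℕ) (x y : Euc n), ‖x - y‖ ≤ N * δ → u x ≤ u y + N * D := by
    intro N
    induction N with
    | zero =>
      intro x y hxy
      have : x = y := by
        have : ‖x - y‖ ≤ 0 := by simpa using hxy
        exact sub_eq_zero.1 (norm_le_zero_iff.1 this)
      simp [this]
    | succ N ih =>
      intro x y hxy
      push_cast at hxy ⊢
      have hN : (0:ℝ) < N + 1 := by positivity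
      let z : Euc n := x - (1 / ((N:ℝ) + 1)) • (x - y)
      have h1 : ‖x - z‖ ≤ δ := by
        have : x - z = (1 / ((N:ℝ) + 1)) • (x - y) := by simp [z]
        rw [this, norm_smul, Real.norm_of_nonneg (by positivity), one_div, inv_mul_le_iff₀ hN]
        exact hxy
      have h2 : ‖z - y‖ ≤ N * δ := by
        have : z - y = ((N:ℝ) / ((N:ℝ) + 1)) • (x - y) := by
          have : (N:ℝ) / ((N:ℝ) + 1) = 1 - 1 / ((N:ℝ)+1) := by field_simp; ring
          rw [this, sub_smul, one_smul]
          simp only [z]; abel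
        rw [this, norm_smul, Real.norm_of_nonneg (by positivity), div_mul_eq_mul_div,
          div_le_iff₀ hN]
        nlinarith [mul_le_mul_of_nonneg_left hxy (Nat.cast_nonneg (α := ℝ) N)]
      have := hu x z h1
      have := ih z y h2
      linarith
  have key2 : ∀ x y : Euc n, u x - u y ≤ D / δ * ‖x - y‖ + D := by
    intro x y
    have h1 := Nat.le_ceil (‖x - y‖ / δ)
    have h2 := Nat.ceil_lt_add_one (show 0 ≤ ‖x - y‖ / δ by positivity)
    rw [div_le_iff₀ hδ] at h1
    have h3 := key _ x y h1
    have h4 := mul_le_mul_of_nonneg_right h2.le hD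
    have : (‖x - y‖ / δ + 1) * D = D / δ * ‖x - y‖ + D := by field_simp
    linarith
  rw [abs_le]
  constructor
  · have := key2 y x
    rw [norm_sub_rev] at this
    linarith
  · exact key2 x y

lemma lim_along {n : ℕ} {l : Filter ℕ} (w : ℕ → Euc n → ℝ) (W : Euc n → ℝ) (K : ℝ) (e : ℕ → ℝ)
    (he : Tendsto e l (𝓝 0)) (hL : ∀ k x y, |w k x - w k y| ≤ K * ‖x - y‖ + e k)
    (hW : ∀ x, Tendsto (fun k => w k x) l (𝓝 (W x))) (x : ℕ → Euc n) (x0 : Euc n)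
    (hx : Tendsto x l (𝓝 x0)) : Tendsto (fun k => w k (x k)) l (𝓝 (W x0)) := by
  have h1 : Tendsto (fun k => K * ‖x k - x0‖ + e k) l (𝓝 0) := by
    have : Tendsto (fun k => K * ‖x k - x0‖ + e k) l (𝓝 (K * ‖x0 - x0‖ + 0)) :=
      ((hx.sub_const x0).norm.const_mul K).add he
    simpa using this
  have h2 : Tendsto (fun k => w k (x k) - w k x0) l (𝓝 0) :=
    squeeze_zero_norm (fun k => hL k _ _) h1
  simpa using h2.add (hW x0)

lemma touch {n : ℕ} (l : Ultrafilter ℕ) (w : ℕ → Euc n → ℝ) (W : Euc n → ℝ) (K : ℝ)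
    (hK : 0 ≤ K) (e : ℕ → ℝ)
    (he : Tendsto e l (𝓝 0)) (hL : ∀ k x y, |w k x - w k y| ≤ K * ‖x - y‖ + e k)
    (hW : ∀ x, Tendsto (fun k => w k x) l (𝓝 (W x)))
    (h : ℕ → ℝ) (hpos : ∀ k, 0 < h k) (h0 : Tendsto h l (𝓝 0))
    (ψ : Euc n → ℝ) (hψc : Continuous ψ) (p x0 : Euc n)
    (hψ : HasStrictFDerivAt ψ (innerSL ℝ p) x0) (hmax : IsLocalMax (fun y => W y - ψ y) x0) :
    ∃ x : ℕ → Euc n, Tendsto x l (𝓝 x0) ∧ ∀ (v : ℕ → Euc n) (G : ℝ), (∀ k, ‖v k‖ ≤ G) →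
      ∀ η > 0, ∀ᶠ k in l, w k (x k + h k • v k) - w k (x k) ≤ h k * (⟪p, v k⟫ + η) := by
  obtain ⟨r, hr, hball⟩ := Metric.nhds_basis_closedBall.eventually_iff.1 hmax
  let φ : Euc n → ℝ := fun y => ψ y + ‖y - x0‖ ^ 2
  have hφc : Continuous φ := by fun_prop
  have hφ : HasStrictFDerivAt φ (innerSL ℝ p) x0 := by
    have h1 : HasStrictFDerivAt (fun y : Euc n => ‖y - x0‖ ^ 2) (0 : Euc n →L[ℝ] ℝ) x0 := by
      have := HasStrictFDerivAt.comp (f := fun y : Euc n => y - x0) x0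
        (hasStrictFDerivAt_norm_sq (x0 - x0)) ((hasStrictFDerivAt_id (𝕜 := ℝ) x0).sub_const x0)
      simp only [sub_self, map_zero, smul_zero, ContinuousLinearMap.zero_comp] at this
      exact this
    have h2 := hψ.add h1
    rw [add_zero] at h2
    exact h2
  have hne : ∀ k, ∃ x ∈ Metric.closedBall x0 r, ∀ y ∈ Metric.closedBall x0 r,
      w k y - φ y ≤ w k x - φ x + h k ^ 2 := by
    intro k
    have hb : BddAbove ((fun y => w k y - φ y) '' Metric.closedBall x0 r) := by
      obtain ⟨B, hB⟩ := (isCompact_closedBall x0 r).bddBelow_image hφc.continuousOn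
      refine ⟨w k x0 + (K * r + e k) - B, ?_⟩
      rintro _ ⟨y, hy, rfl⟩
      have h1 := hB ⟨y, hy, rfl⟩
      have h2 := (abs_le.1 (hL k y x0)).2
      have h3 : ‖y - x0‖ ≤ r := by simpa [dist_eq_norm] using hy
      have h4 := mul_le_mul_of_nonneg_left h3 hK
      dsimp only
      linarith
    have hn : ((fun y => w k y - φ y) '' Metric.closedBall x0 r).Nonempty :=
      ⟨_, x0, Metric.mem_closedBall_self hr.le, rfl⟩
    obtain ⟨_, ⟨x, hx, rfl⟩, hlt⟩ := exists_lt_of_lt_csSup hn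
      (show sSup ((fun y => w k y - φ y) '' Metric.closedBall x0 r) - h k ^ 2 <
        sSup ((fun y => w k y - φ y) '' Metric.closedBall x0 r) by
          have := hpos k; nlinarith)
    refine ⟨x, hx, fun y hy => ?_⟩
    have := le_csSup hb ⟨y, hy, rfl⟩
    dsimp only at this hlt
    linarith
  choose x hxb hx using hne
  have hlim : Tendsto x l (𝓝 x0) := by
    obtain ⟨a, ha, hxa⟩ := (isCompact_closedBall x0 r).ultrafilter_le_nhds (l.map x)
      (by rw [le_principal_iff]; exact Filter.Eventually.of_forall (f := (l : Filter ℕ)) hxb)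
    have hxa : Tendsto x l (𝓝 a) := hxa
    have h1 := lim_along w W K e he hL hW x a hxa
    have h2 : W x0 - φ x0 ≤ W a - φ a + 0 ^ 2 := by
      refine le_of_tendsto_of_tendsto ((hW x0).sub_const (φ x0))
        ((h1.sub ((hφc.tendsto a).comp hxa)).add (h0.pow 2)) ?_
      exact Filter.Eventually.of_forall fun k => hx k x0 (Metric.mem_closedBall_self hr.le)
    have h3 : W a - ψ a ≤ W x0 - ψ x0 := hball ha
    have h4 : ‖a - x0‖ ^ 2 ≤ 0 := by
      simp only [φ, sub_self, norm_zero] at h2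
      nlinarith
    have h5 : a = x0 := by
      have : ‖a - x0‖ = 0 := by nlinarith [norm_nonneg (a - x0)]
      exact sub_eq_zero.1 (norm_eq_zero.1 this)
    rwa [h5] at hxa
  refine ⟨x, hlim, fun v G hv η hη => ?_⟩
  have hG : 0 ≤ G := (norm_nonneg _).trans (hv 0)
  have hy : Tendsto (fun k => x k + h k • v k) l (𝓝 x0) := by
    have : Tendsto (fun k => h k • v k) l (𝓝 0) := by
      refine squeeze_zero_norm (a := fun k => h k * G) (fun k => ?_) (by simpa using h0.mul_const G)
      rw [norm_smul, Real.norm_of_nonneg (hpos k).le]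
      exact mul_le_mul_of_nonneg_left (hv k) (hpos k).le
    simpa using hlim.add this
  have hc : 0 < η / (2 * (G + 1)) := by positivity
  have hs := (hφ.isLittleO.def hc)
  have hs' := (hy.prodMk_nhds hlim).eventually hs
  have hin : ∀ᶠ k in l, x k + h k • v k ∈ Metric.closedBall x0 r :=
    hy.eventually (Metric.closedBall_mem_nhds x0 hr)
  have hsm : ∀ᶠ k in l, h k < η / 2 := h0.eventually (gt_mem_nhds (by positivity))
  filter_upwards [hs', hin, hsm] with k h1 h2 h3
  have h4 := hx k _ h2
  simp only [add_sub_cancel_left, map_smul, innerSL_apply_apply, smul_eq_mul, norm_smul,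
    Real.norm_of_nonneg (hpos k).le] at h1
  have h5 := (abs_le.1 (by simpa only [Real.norm_eq_abs] using h1)).2
  have h6 : η / (2 * (G + 1)) * (h k * ‖v k‖) ≤ h k * (η / 2) := by
    have : η / (2 * (G + 1)) * (h k * ‖v k‖) ≤ η / (2 * (G + 1)) * (h k * (G + 1)) := by
      have := hv k
      have := hpos k
      gcongr
      linarith
    refine this.trans (le_of_eq ?_)
    field_simp
  have h7 := hpos k
  nlinarith

lemma ultra_real (l : Ultrafilter ℕ) (f : ℕ → ℝ) (A : ℝ) (hf : ∀ k, |f k| ≤ A) :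
    ∃ a, Tendsto f l (𝓝 a) := by
  obtain ⟨a, -, ha⟩ := (isCompact_Icc (a := -A) (b := A)).ultrafilter_le_nhds (l.map f)
    (by
      rw [le_principal_iff]
      exact Filter.Eventually.of_forall (f := (l : Filter ℕ)) fun k => abs_le.1 (hf k))
  exact ⟨a, ha⟩

lemma strict_grad {n : ℕ} (ψ : Euc n → ℝ) (hψ : ContDiff ℝ 1 ψ) (x : Euc n) :
    HasStrictFDerivAt ψ (innerSL ℝ (gradient ψ x)) x := by
  have h1 := hψ.hasStrictFDerivAt (x := x) one_ne_zero
  have h2 : innerSL ℝ (gradient ψ x) = fderiv ℝ ψ x := by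
    rw [← toDual_gradient]; rfl
  rw [h2]; exact h1

lemma scalar_main {n : ℕ} {X : Type*} [TopologicalSpace X] [CompactSpace X] [Nonempty X]
    (g : Euc n × X → Euc n) (L : Euc n × X → ℝ) (hg : Continuous g) (hLc : Continuous L)
    (hgp : TorusFun2 g) (hLp : TorusFun2 L) (G C : ℝ) (hG : ∀ q, ‖g q‖ ≤ G)
    (hC : ∀ q, |L q| ≤ C) (δ : ℝ) (hδ : 0 < δ)
    (hctrl : ∀ x e : Euc n, ‖e‖ ≤ δ → ∃ ξ, g (x, ξ) = e) (b : ℝ) (hb : 0 ≤ b) :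
    ∃ (c : ℝ) (W : Euc n → ℝ), (∃ K : NNReal, LipschitzWith K W) ∧ TorusFun W ∧
      (∀ ψ : Euc n → ℝ, ContDiff ℝ 1 ψ → ∀ x, IsLocalMax (fun y => W y - ψ y) x →
        ∀ ξ, b * W x + (-⟪g (x, ξ), gradient ψ x⟫ - L (x, ξ)) ≤ c) ∧
      (∀ ψ : Euc n → ℝ, ContDiff ℝ 1 ψ → ∀ x, IsLocalMin (fun y => W y - ψ y) x →
        ∃ ξ, c ≤ b * W x + (-⟪g (x, ξ), gradient ψ x⟫ - L (x, ξ))) := by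
  have hC0 : 0 ≤ C := (abs_nonneg _).trans (hC (0, Classical.arbitrary X))
  let lam : ℕ → ℝ := fun k => b + 1 / ((k : ℝ) + 1)
  let h : ℕ → ℝ := fun k => 1 / (b + 1) * (1 / ((k : ℝ) + 1))
  have hlam : ∀ k, 0 < lam k := fun k => by positivity
  have hh : ∀ k, 0 < h k := fun k => by positivity
  have hk1 : ∀ k : ℕ, 1 / ((k : ℝ) + 1) ≤ 1 := fun k => by
    rw [div_le_one (by positivity)]; linarith [Nat.cast_nonneg (α := ℝ) k]
  have hlh : ∀ k, lam k * h k ≤ 1 := fun k => by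
    have h1 : lam k ≤ b + 1 := by simp only [lam]; linarith [hk1 k]
    have h2 : h k ≤ 1 / (b + 1) :=
      mul_le_of_le_one_right (by positivity) (hk1 k)
    calc lam k * h k ≤ (b + 1) * (1 / (b + 1)) :=
          mul_le_mul h1 h2 (hh k).le (by linarith)
      _ = 1 := by field_simp
  have hex := fun k => exists_discrete g L hgp hLp C hC (lam k) (h k) (hlam k) (hh k) (hlh k)
  choose u hup hub hule huge using hex
  let l : Ultrafilter ℕ := hyperfilter ℕ
  have hl : (l : Filter ℕ) ≤ atTop := Nat.hyperfilter_le_atTop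
  have hinv : Tendsto (fun k : ℕ => 1 / ((k : ℝ) + 1)) l (𝓝 0) :=
    (tendsto_one_div_add_atTop_nhds_zero_nat (𝕜 := ℝ)).mono_left hl
  have hlim_lam : Tendsto lam l (𝓝 b) := by simpa [lam] using hinv.const_add b
  have hlim_h : Tendsto h l (𝓝 0) := by simpa [h] using hinv.const_mul (1 / (b + 1))
  -- asymptotic Lipschitz bound
  have hstep : ∀ k x y, ‖x - y‖ ≤ δ * h k → u k x ≤ u k y + 2 * C * h k := by
    intro k x y hxy
    obtain ⟨ξ, hξ⟩ := hctrl x ((h k)⁻¹ • (y - x)) (by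
      rw [norm_smul, norm_inv, Real.norm_of_nonneg (hh k).le, norm_sub_rev,
        inv_mul_le_iff₀ (hh k), mul_comm]
      exact hxy)
    have h1 := hule k x ξ
    rw [hξ, smul_inv_smul₀ (hh k).ne', add_sub_cancel] at h1
    have h2 := mul_le_mul_of_nonneg_left (abs_le.1 (hC (x, ξ))).2 (hh k).le
    have h3 : -(lam k * u k y) ≤ C := by
      have := hub k y
      have h4 := mul_le_mul_of_nonneg_left (neg_le_abs (u k y)) (hlam k).le
      linarith
    have h4 := mul_le_mul_of_nonneg_right h3 (hh k).le
    linarith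
  have hK0 : 0 ≤ 2 * C / δ := by positivity
  have hlipu : ∀ k x y, |u k x - u k y| ≤ 2 * C / δ * ‖x - y‖ + 2 * C * h k := by
    intro k x y
    have hhk := hh k
    have := asymp_lip (u k) (δ * h k) (2 * C * h k) (by positivity) (by positivity) (hstep k) x y
    rwa [mul_div_mul_right _ _ hhk.ne'] at this
  let w : ℕ → Euc n → ℝ := fun k x => u k x - u k 0
  have hlip : ∀ k x y, |w k x - w k y| ≤ 2 * C / δ * ‖x - y‖ + 2 * C * h k := by
    intro k x y
    simpa [w] using hlipu k x y
  have he : Tendsto (fun k => 2 * C * h k) l (𝓝 0) := by simpa using hlim_h.const_mul (2 * C)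
  have hhle : ∀ k, h k ≤ 1 / (b + 1) := fun k => mul_le_of_le_one_right (by positivity) (hk1 k)
  have hWex : ∀ x, ∃ a, Tendsto (fun k => w k x) l (𝓝 a) := by
    intro x
    refine ultra_real l _ (2 * C / δ * ‖x‖ + 2 * C * (1 / (b + 1))) fun k => ?_
    have h1 := hlipu k x 0
    rw [sub_zero] at h1
    have := mul_le_mul_of_nonneg_left (hhle k) (show 0 ≤ 2 * C by positivity)
    simp only [w]
    linarith
  choose W hW using hWex
  obtain ⟨a, ha⟩ := ultra_real l (fun k => lam k * u k 0) C fun k => by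
    rw [abs_mul, abs_of_pos (hlam k)]; exact hub k 0
  -- limit of `lam k * u k (y k)`
  have hlimu : ∀ (y : ℕ → Euc n) x0, Tendsto y l (𝓝 x0) →
      Tendsto (fun k => lam k * u k (y k)) l (𝓝 (b * W x0 + a)) := by
    intro y x0 hy
    have h1 := lim_along w W _ _ he hlip hW y x0 hy
    refine ((hlim_lam.mul h1).add ha).congr fun k => ?_
    simp only [w]; ring
  have hmove : ∀ (x v : ℕ → Euc n) x0, Tendsto x l (𝓝 x0) → (∀ k, ‖v k‖ ≤ G) →
      Tendsto (fun k => x k + h k • v k) l (𝓝 x0) := by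
    intro x v x0 hx hv
    have : Tendsto (fun k => h k • v k) l (𝓝 0) := by
      refine squeeze_zero_norm (a := fun k => h k * G) (fun k => ?_)
        (by simpa using hlim_h.mul_const G)
      rw [norm_smul, Real.norm_of_nonneg (hh k).le]
      exact mul_le_mul_of_nonneg_left (hv k) (hh k).le
    simpa using hx.add this
  refine ⟨-a, W, ⟨(2 * C / δ).toNNReal, ?_⟩, ?_, ?_, ?_⟩
  · refine LipschitzWith.of_dist_le_mul fun x y => ?_
    rw [Real.coe_toNNReal _ hK0, Real.dist_eq, dist_eq_norm]
    have h1 : Tendsto (fun k => |w k x - w k y|) l (𝓝 |W x - W y|) := ((hW x).sub (hW y)).abs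
    have h2 : Tendsto (fun k => 2 * C / δ * ‖x - y‖ + 2 * C * h k) l
        (𝓝 (2 * C / δ * ‖x - y‖ + 0)) := he.const_add _
    rw [add_zero] at h2
    exact le_of_tendsto_of_tendsto h1 h2 (Filter.Eventually.of_forall fun k => hlip k x y)
  · intro x z hz
    refine tendsto_nhds_unique (hW (x + z)) ((hW x).congr fun k => ?_)
    simp only [w]
    rw [hup k x z hz]
  · intro ψ hψ x0 hmax ξ
    obtain ⟨x, hx, htouch⟩ := touch l w W _ hK0 _ he hlip hW h hh hlim_h ψ hψ.continuous
      (gradient ψ x0) x0 (strict_grad ψ hψ x0) hmax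
    have hv : ∀ k, ‖g (x k, ξ)‖ ≤ G := fun k => hG _
    have hgl : Tendsto (fun k => g (x k, ξ)) l (𝓝 (g (x0, ξ))) :=
      (hg.tendsto (x0, ξ)).comp (hx.prodMk_nhds tendsto_const_nhds)
    have hLl : Tendsto (fun k => L (x k, ξ)) l (𝓝 (L (x0, ξ))) :=
      (hLc.tendsto (x0, ξ)).comp (hx.prodMk_nhds tendsto_const_nhds)
    refine le_of_forall_pos_le_add fun η hη => ?_
    have hlim1 : Tendsto (fun k => lam k * u k (x k + h k • g (x k, ξ)) - L (x k, ξ)) l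
        (𝓝 (b * W x0 + a - L (x0, ξ))) :=
      (hlimu _ x0 (hmove x _ x0 hx hv)).sub hLl
    have hlim2 : Tendsto (fun k => ⟪gradient ψ x0, g (x k, ξ)⟫ + η) l
        (𝓝 (⟪gradient ψ x0, g (x0, ξ)⟫ + η)) := (tendsto_const_nhds.inner hgl).add_const η
    have := le_of_tendsto_of_tendsto hlim1 hlim2 (by
      filter_upwards [htouch _ G hv η hη] with k h1
      have h2 := hule k (x k) ξ
      simp only [w] at h1
      refine le_of_mul_le_mul_left ?_ (hh k)
      linarith)
    rw [real_inner_comm] at this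
    linarith
  · intro ψ hψ x0 hmin
    have hsg : HasStrictFDerivAt (fun y => -ψ y) (innerSL ℝ (-gradient ψ x0)) x0 := by
      rw [map_neg]; exact (strict_grad ψ hψ x0).neg
    have hmax : IsLocalMax (fun y => -W y - -ψ y) x0 := by
      have := hmin.neg
      refine this.congr (Filter.Eventually.of_forall fun y => ?_)
      simp only []; ring
    obtain ⟨x, hx, htouch⟩ := touch l (fun k y => -w k y) (fun y => -W y) _ hK0 _ he
      (fun k x y => by
        have := hlip k x y
        rwa [← abs_neg, show -(-w k x - -w k y) = w k x - w k y by ring])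
      (fun y => (hW y).neg) h hh hlim_h (fun y => -ψ y) hψ.continuous.neg
      (-gradient ψ x0) x0 hsg hmax
    have hξ := fun k => huge k (x k) (h k ^ 2) (pow_pos (hh k) 2)
    choose ξ hξ using hξ
    have hv : ∀ k, ‖g (x k, ξ k)‖ ≤ G := fun k => hG _
    obtain ⟨ξ0, -, hξ0⟩ := (isCompact_univ (X := X)).ultrafilter_le_nhds (l.map ξ) (by simp)
    have hξ0 : Tendsto ξ l (𝓝 ξ0) := hξ0
    have hgl : Tendsto (fun k => g (x k, ξ k)) l (𝓝 (g (x0, ξ0))) :=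
      (hg.tendsto (x0, ξ0)).comp (hx.prodMk_nhds hξ0)
    have hLl : Tendsto (fun k => L (x k, ξ k)) l (𝓝 (L (x0, ξ0))) :=
      (hLc.tendsto (x0, ξ0)).comp (hx.prodMk_nhds hξ0)
    refine ⟨ξ0, le_of_forall_pos_le_add fun η hη => ?_⟩
    have hlim1 : Tendsto (fun k => lam k * u k (x k + h k • g (x k, ξ k)) - L (x k, ξ k) + h k) l
        (𝓝 (b * W x0 + a - L (x0, ξ0) + 0)) :=
      ((hlimu _ x0 (hmove x _ x0 hx hv)).sub hLl).add hlim_h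
    have hlim2 : Tendsto (fun k => ⟪gradient ψ x0, g (x k, ξ k)⟫ - η) l
        (𝓝 (⟪gradient ψ x0, g (x0, ξ0)⟫ - η)) := (tendsto_const_nhds.inner hgl).sub_const η
    have := le_of_tendsto_of_tendsto hlim2 hlim1 (by
      filter_upwards [htouch _ G hv η hη] with k h1
      have h2 := hξ k
      simp only [w, inner_neg_left] at h1
      refine le_of_mul_le_mul_left ?_ (hh k)
      linarith)
    rw [real_inner_comm] at this
    linarith

lemma periodic_bdd {n : ℕ} {X : Type*} [TopologicalSpace X] [CompactSpace X]
    {E : Type*} [NormedAddCommGroup E] (f : Euc n × X → E) (hf : Continuous f)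
    (hp : TorusFun2 f) : ∃ C, 0 ≤ C ∧ ∀ q, ‖f q‖ ≤ C := by
  let Q : Set (Euc n) := (fun y => WithLp.toLp 2 y) '' (Set.univ.pi fun _ : Fin n => Set.Icc (0:ℝ) 1)
  have hQ : IsCompact Q := (isCompact_univ_pi fun _ => isCompact_Icc).image (by fun_prop)
  obtain ⟨C, hC⟩ := (hQ.prod (isCompact_univ (X := X))).exists_bound_of_continuousOn
    hf.continuousOn
  refine ⟨max C 0, le_max_right _ _, ?_⟩
  rintro ⟨x, ξ⟩
  let y : Euc n := WithLp.toLp 2 fun i => Int.fract (x i)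
  let z : Euc n := WithLp.toLp 2 fun i => ((⌊x i⌋ : ℤ) : ℝ)
  have hxy : x = y + z := by
    ext i
    simp [y, z]
  have hz : IsIntVec z := fun i => ⟨⌊x i⌋, rfl⟩
  rw [hxy, hp y z ξ hz]
  refine (hC (y, ξ) ⟨⟨_, ?_, rfl⟩, trivial⟩).trans (le_max_left _ _)
  intro i _
  exact ⟨Int.fract_nonneg _, (Int.fract_lt_one _).le⟩

lemma scalar_full {n m : ℕ} {Ξ : Type*} [MetricSpace Ξ] [CompactSpace Ξ] [Nonempty Ξ]
    (g : Fin m → Euc n × Ξ → Euc n) (L : Fin m → Euc n × Ξ → ℝ)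
    (hgL : GoodData g L) (hcoer : Coercive g L) (b : ℝ) (hb : 0 ≤ b) (i : Fin m) :
    ∃ (c : ℝ) (W : Euc n → ℝ), (∃ K : NNReal, LipschitzWith K W) ∧ TorusFun W ∧
      (∀ ψ : Euc n → ℝ, ContDiff ℝ 1 ψ → ∀ x, IsLocalMax (fun y => W y - ψ y) x →
        b * W x + ham g L i x (gradient ψ x) ≤ c) ∧
      (∀ ψ : Euc n → ℝ, ContDiff ℝ 1 ψ → ∀ x, IsLocalMin (fun y => W y - ψ y) x →
        c ≤ b * W x + ham g L i x (gradient ψ x)) := by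
  obtain ⟨hg, hgp⟩ := hgL.1 i
  obtain ⟨hLc, hLp⟩ := hgL.2 i
  obtain ⟨G, hG0, hG⟩ := periodic_bdd _ hg hgp
  obtain ⟨C, hC0, hC⟩ := periodic_bdd _ hLc hLp
  obtain ⟨R0, hR0⟩ := hcoer i (2 * C + 2)
  let R := max R0 1
  have hR1 : 0 < R := lt_of_lt_of_le one_pos (le_max_right _ _)
  let δ := 1 / R
  have hδ : 0 < δ := by positivity
  have hbdd : ∀ x p, BddAbove (Set.range fun ξ : Ξ => -⟪g i (x, ξ), p⟫ - L i (x, ξ)) := by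
    intro x p
    refine ⟨G * ‖p‖ + C, ?_⟩
    rintro _ ⟨ξ, rfl⟩
    have h1 := abs_le.1 ((abs_real_inner_le_norm (g i (x, ξ)) p).trans
      (mul_le_mul_of_nonneg_right (hG (x, ξ)) (norm_nonneg p)))
    have h2 := abs_le.1 (hC (x, ξ))
    dsimp only
    linarith [h1.1, h2.1]
  have hle : ∀ x p ξ, -⟪g i (x, ξ), p⟫ - L i (x, ξ) ≤ ham g L i x p :=
    fun x p ξ => le_ciSup (hbdd x p) ξ
  -- linear growth of the Hamiltonian
  have hgrow : ∀ x p, δ * ‖p‖ - C ≤ ham g L i x p := by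
    intro x p
    by_cases hp : p = 0
    · subst hp
      have h1 := hle x 0 (Classical.arbitrary Ξ)
      have h2 := abs_le.1 (hC (x, Classical.arbitrary Ξ))
      simp only [inner_zero_right, norm_zero] at h1 ⊢
      linarith [h2.2]
    · have hp' : 0 < ‖p‖ := norm_pos_iff.2 hp
      let q : Euc n := (R / ‖p‖) • p
      have hq : ‖q‖ = R := by
        simp only [q]
        rw [norm_smul, Real.norm_of_nonneg (by positivity)]; field_simp
      have h1 := hR0 q (by rw [hq]; exact le_max_left _ _) x
      obtain ⟨ξ, hξ⟩ := exists_lt_of_lt_ciSup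
        (show 2 * C + 1 < ham g L i x q by linarith)
      have h2 := abs_le.1 (hC (x, ξ))
      have h3 : 1 ≤ -⟪g i (x, ξ), q⟫ := by linarith [h2.1]
      have h4 : -⟪g i (x, ξ), q⟫ = (R / ‖p‖) * (-⟪g i (x, ξ), p⟫) := by
        simp only [q]; rw [inner_smul_right]; ring
      have h5 : δ * ‖p‖ ≤ -⟪g i (x, ξ), p⟫ := by
        rw [h4, div_mul_eq_mul_div, le_div_iff₀ hp'] at h3
        simp only [δ]
        rw [div_mul_eq_mul_div, div_le_iff₀ hR1]
        linarith
      linarith [hle x p ξ, h2.2]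
  -- enlarge the control set
  let X := Ξ ⊕ (Metric.closedBall (0 : Euc n) δ)
  have : CompactSpace (Metric.closedBall (0 : Euc n) δ) :=
    isCompact_iff_compactSpace.1 (isCompact_closedBall _ _)
  let g' : Euc n × X → Euc n := fun q => Sum.elim (fun ξ => g i (q.1, ξ)) (fun e => e.1) q.2
  let L' : Euc n × X → ℝ := fun q => Sum.elim (fun ξ => L i (q.1, ξ)) (fun _ => C) q.2
  have hcont : ∀ {E : Type} [TopologicalSpace E] (f : Euc n × X → E),
      Continuous (fun q : Euc n × Ξ => f (q.1, Sum.inl q.2)) →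
      Continuous (fun q : Euc n × (Metric.closedBall (0 : Euc n) δ) => f (q.1, Sum.inr q.2)) →
      Continuous f := by
    intro E _ f h1 h2
    have h3 : Continuous (Sum.elim (fun q : Euc n × Ξ => f (q.1, Sum.inl q.2))
      (fun q : Euc n × (Metric.closedBall (0 : Euc n) δ) => f (q.1, Sum.inr q.2))) :=
      Continuous.sumElim h1 h2
    have h4 := h3.comp (Homeomorph.prodSumDistrib (X := Euc n) (Y := Ξ)
      (Z := Metric.closedBall (0 : Euc n) δ)).continuous
    refine h4.congr ?_
    rintro ⟨x, ξ | ξ⟩ <;> rfl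
  have hg' : Continuous g' := hcont g' hg (continuous_subtype_val.comp continuous_snd)
  have hL' : Continuous L' := hcont L' hLc continuous_const
  obtain ⟨c, W, hlip, hper, hsub, hsup⟩ := scalar_main g' L' hg' hL'
    (by
      rintro x z (ξ | e) hz
      · exact hgp x z ξ hz
      · rfl)
    (by
      rintro x z (ξ | e) hz
      · exact hLp x z ξ hz
      · rfl)
    (max G δ) C
    (by
      rintro ⟨x, ξ | e⟩
      · exact (hG _).trans (le_max_left _ _)
      · exact (mem_closedBall_zero_iff.1 e.2).trans (le_max_right _ _))
    (by
      rintro ⟨x, ξ | e⟩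
      · exact hC _
      · exact (abs_of_nonneg hC0).le)
    δ hδ (fun x e he => ⟨Sum.inr ⟨e, mem_closedBall_zero_iff.2 he⟩, rfl⟩) b hb
  refine ⟨c, W, hlip, hper, ?_, ?_⟩
  · intro ψ hψ x hx
    have : ham g L i x (gradient ψ x) ≤ c - b * W x := by
      refine ciSup_le fun ξ => ?_
      have := hsub ψ hψ x hx (Sum.inl ξ)
      simp only [g', L', Sum.elim_inl] at this
      linarith
    linarith
  · intro ψ hψ x hx
    obtain ⟨ξ | e, hξ⟩ := hsup ψ hψ x hx
    · simp only [g', L', Sum.elim_inl] at hξ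
      linarith [hle x (gradient ψ x) ξ]
    · simp only [g', L', Sum.elim_inr] at hξ
      have h1 := hgrow x (gradient ψ x)
      have h2 := abs_le.1 ((abs_real_inner_le_norm e.1 (gradient ψ x)).trans
        (mul_le_mul_of_nonneg_right (mem_closedBall_zero_iff.1 e.2) (norm_nonneg _)))
      linarith [h2.1]

theorem stmt17 {n m : ℕ} (hn : 0 < n) (hm : 0 < m)
    {Ξ : Type*} [MetricSpace Ξ] [CompactSpace Ξ] [Nonempty Ξ]
    (g : Fin m → Euc n × Ξ → Euc n) (L : Fin m → Euc n × Ξ → ℝ)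
    (hgL : GoodData g L) (hcoer : Coercive g L)
    (b : Fin m → ℝ) (hb : ∀ i, 0 ≤ b i) :
    ∃ (c : Fin m → ℝ) (v : Fin m → Euc n → ℝ),
      (∀ i, ∃ K : NNReal, LipschitzWith K (v i)) ∧
      IsSol (fun _ => Matrix.diagonal b) 0 g L c v := by
  choose c v hlip hper hsub hsup using fun i => scalar_full g L hgL hcoer (b i) (hb i) i
  have hcont : ∀ i, Continuous (v i) := fun i => by
    obtain ⟨K, hK⟩ := hlip i
    exact hK.continuous
  have hsum : ∀ (i : Fin m) (x : Euc n),
      (∑ j, Matrix.diagonal b i j * v j x) = b i * v i x := by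
    intro i x
    simp [Matrix.diagonal_apply]
  refine ⟨c, v, hlip, hcont, ⟨fun i => ⟨(hcont i).upperSemicontinuous, hper i⟩, ?_⟩,
    ⟨fun i => ⟨(hcont i).lowerSemicontinuous, hper i⟩, ?_⟩⟩
  · intro i ψ hψ _ x hx
    rw [hsum, zero_mul, zero_add]
    exact hsub i ψ hψ x hx
  · intro i ψ hψ _ x hx
    rw [hsum, zero_mul, zero_add]
    exact hsup i ψ hψ x hx
end
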